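/- Suppose μ is a positive Borel measure on 𝒰 satisfying ∫_𝒰 |wₙ + i|^{−α₀} dμ(w) < ∞ for some α₀ > 0 and which is a Carleson measure for A^q(𝒰) for some q ∈ (0, ∞). Let 1 < p < ∞ and n + 1/p < α < n + 1. Then there exists C > 0 such that for all f ∈ 𝒮_α, the function T_μ f(z) = ∫_𝒰 K(z,w) f(w) dμ(w) belongs to Aᵖ(𝒰) and ‖T_μ f‖ₚ ≤ C ‖f‖ₚ; in particular T_μ extends to a bounded operator on Aᵖ(𝒰). -/

import Mathlib

open MeasureTheory Filter

noncomputable section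

/-- Points of ℂⁿ written `z = (z′, zₙ)` with `z′ ∈ ℂ^m`, `m = n - 1`. -/
abbrev SPoint (m : ℕ) := (Fin m → ℂ) × ℂ

/-- `ρ(z,w) = (i/2)(w̄ₙ − zₙ) − z′·w̄′`. -/
def srho2 {m : ℕ} (z w : SPoint m) : ℂ :=
  Complex.I / 2 * ((starRingEnd ℂ) w.2 - z.2) - ∑ j, z.1 j * (starRingEnd ℂ) (w.1 j)

/-- `ρ(z) = Im zₙ − |z′|²`. -/
def srho {m : ℕ} (z : SPoint m) : ℝ :=
  z.2.im - ∑ j, ‖z.1 j‖ ^ 2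

/-- The Siegel upper half-space `𝒰 = {z : ρ(z) > 0}`. -/
def Siegel (m : ℕ) : Set (SPoint m) := {z | 0 < srho z}

/-- The Bergman kernel `K(z,w) = (n!/(4πⁿ)) ρ(z,w)^{−(n+1)}` (points in ℂⁿ = ℂ^{n-1} × ℂ). -/
def sK (n : ℕ) (z w : SPoint (n - 1)) : ℂ :=
  (n.factorial : ℂ) / (4 * (Real.pi : ℂ) ^ n) * srho2 z w ^ (-(n + 1 : ℤ))

/-- Inverse hyperbolic tangent. -/
def artanh (x : ℝ) : ℝ := (1 / 2) * Real.log ((1 + x) / (1 - x))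

/-- The Bergman distance `β(z,w) = artanh √(1 − ρ(z)ρ(w)/|ρ(z,w)|²)`. -/
def sbeta {m : ℕ} (z w : SPoint m) : ℝ :=
  artanh (Real.sqrt (1 - srho z * srho w / ‖srho2 z w‖ ^ 2))

/-- The Bergman metric ball `D(z,r)`. -/
def sball {m : ℕ} (z : SPoint m) (r : ℝ) : Set (SPoint m) :=
  {w ∈ Siegel m | sbeta z w < r}

/-- Membership in the Bergman space `Aᵖ(𝒰)`: holomorphic with `∫_𝒰 |f|ᵖ dV < ∞`. -/
def MemAp (n : ℕ) (p : ℝ) (f : SPoint (n - 1) → ℂ) : Prop :=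
  DifferentiableOn ℂ f (Siegel (n - 1)) ∧
    IntegrableOn (fun z => ‖f z‖ ^ p) (Siegel (n - 1)) volume

/-- `‖f‖ₚ = (∫_𝒰 |f|ᵖ dV)^{1/p}`. -/
def bNorm (n : ℕ) (p : ℝ) (f : SPoint (n - 1) → ℂ) : ℝ :=
  (∫ z in Siegel (n - 1), ‖f z‖ ^ p) ^ (1 / p)

/-- The space `𝒮_α` of holomorphic `f` on `𝒰` with `sup_z |zₙ + i|^α |f(z)| < ∞`. -/
def SAlpha (n : ℕ) (α : ℝ) (f : SPoint (n - 1) → ℂ) : Prop :=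
  DifferentiableOn ℂ f (Siegel (n - 1)) ∧
    ∃ M : ℝ, ∀ z ∈ Siegel (n - 1), ‖z.2 + Complex.I‖ ^ α * ‖f z‖ ≤ M

end

/-- The real part of `ρ(z,w)` is `(ρ(z) + ρ(w) + |z′ - w′|²) / 2`. -/
lemma srho2_re {m : ℕ} (z w : SPoint m) :
    (srho2 z w).re = (srho z + srho w + ∑ j, ‖z.1 j - w.1 j‖ ^ 2) / 2 := by
  have h : ∀ j, (z.1 j * (starRingEnd ℂ) (w.1 j)).re =
      (‖z.1 j‖ ^ 2 + ‖w.1 j‖ ^ 2 - ‖z.1 j - w.1 j‖ ^ 2) / 2 := by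
    intro j
    simp only [Complex.sq_norm, Complex.normSq_apply, Complex.mul_re, Complex.conj_re,
      Complex.conj_im, Complex.sub_re, Complex.sub_im]
    ring
  simp only [srho2, srho, Complex.sub_re, Complex.re_sum, h]
  rw [← Finset.sum_div, Finset.sum_sub_distrib, Finset.sum_add_distrib]
  simp [Complex.mul_re]
  ring

lemma srho2_im {m : ℕ} (z w : SPoint m) :
    (srho2 z w).im =
      (w.2.re - z.2.re) / 2 - (∑ j, z.1 j * (starRingEnd ℂ) (w.1 j)).im := by
  simp [srho2, Complex.mul_im]
  ring

lemma conj_srho2 {m : ℕ} (z w : SPoint m) :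
    (starRingEnd ℂ) (srho2 z w) = srho2 w z := by
  simp only [srho2, map_sub, map_mul, map_sum, Complex.conj_conj, map_div₀, Complex.conj_I,
    map_ofNat]
  rw [Finset.sum_congr rfl (fun j _ => mul_comm _ _)]
  simp
  ring

lemma norm_srho2_comm {m : ℕ} (z w : SPoint m) : ‖srho2 z w‖ = ‖srho2 w z‖ := by
  rw [← conj_srho2, RCLike.norm_conj]

lemma srho2_self {m : ℕ} (z : SPoint m) : srho2 z z = srho z := by
  apply Complex.ext
  · simp [srho2_re]
  · simp [srho2_im, Complex.mul_conj]

lemma le_norm_srho2 {m : ℕ} (z w : SPoint m) :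
    (srho z + srho w + ∑ j, ‖z.1 j - w.1 j‖ ^ 2) / 2 ≤ ‖srho2 z w‖ :=
  srho2_re z w ▸ Complex.re_le_norm _

lemma norm_srho2_pos {m : ℕ} {z w : SPoint m} (hz : z ∈ Siegel m) (hw : w ∈ Siegel m) :
    0 < ‖srho2 z w‖ := by
  refine lt_of_lt_of_le ?_ (le_norm_srho2 z w)
  have hs : 0 ≤ ∑ j, ‖z.1 j - w.1 j‖ ^ 2 := by positivity
  have h1 : 0 < srho z := hz
  have h2 : 0 < srho w := hw
  linarith

lemma continuous_srho {m : ℕ} : Continuous (srho : SPoint m → ℝ) := by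
  unfold srho
  fun_prop

lemma continuous_srho2 {m : ℕ} :
    Continuous (fun x : SPoint m × SPoint m => srho2 x.1 x.2) := by
  unfold srho2
  fun_prop

lemma isOpen_siegel (m : ℕ) : IsOpen (Siegel m) :=
  isOpen_lt continuous_const continuous_srho

lemma measurableSet_siegel (m : ℕ) : MeasurableSet (Siegel m) :=
  (isOpen_siegel m).measurableSet

lemma differentiable_srho2 {m : ℕ} (w : SPoint m) :
    Differentiable ℂ (fun z => srho2 z w) := by
  unfold srho2
  fun_prop

lemma sq_norm_le_sum {m : ℕ} (x : Fin m → ℂ) : ‖x‖ ^ 2 ≤ ∑ j, ‖x j‖ ^ 2 := by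
  have hs : 0 ≤ ∑ j, ‖x j‖ ^ 2 := by positivity
  rw [← Real.le_sqrt (norm_nonneg _) hs, pi_norm_le_iff_of_nonneg (Real.sqrt_nonneg _)]
  intro j
  rw [Real.le_sqrt (norm_nonneg _) hs]
  exact Finset.single_le_sum (f := fun j => ‖x j‖ ^ 2) (fun _ _ => by positivity)
    (Finset.mem_univ j)

lemma sum_le_sq_norm {m : ℕ} (x : Fin m → ℂ) : ∑ j, ‖x j‖ ^ 2 ≤ m * ‖x‖ ^ 2 := by
  have h : ∑ j : Fin m, ‖x j‖ ^ 2 ≤ ∑ _j : Fin m, ‖x‖ ^ 2 :=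
    Finset.sum_le_sum fun j _ => by
      gcongr
      exact norm_le_pi_norm x j
  simpa using h

noncomputable section

/-- The Heisenberg translate of `ζ` by `w`. -/
def heis {m : ℕ} (w ζ : SPoint m) : SPoint m :=
  (ζ.1 + w.1, ζ.2 + (w.2 + 2 * Complex.I * ∑ j, ζ.1 j * (starRingEnd ℂ) (w.1 j)))

/-- The inverse of `heis w`. -/
def heisInv {m : ℕ} (w x : SPoint m) : SPoint m :=
  (x.1 - w.1, x.2 - (w.2 + 2 * Complex.I * ∑ j, (x.1 j - w.1 j) * (starRingEnd ℂ) (w.1 j)))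

/-- An anisotropic polydisc of size `r` about the origin. -/
def polydisc (m : ℕ) (r : ℝ) : Set (SPoint m) :=
  {ζ | ‖ζ.1‖ ^ 2 < r / (4 * (m + 1)) ∧ ‖ζ.2‖ < r / (4 * (m + 1))}

/-- The pairs `(w, x)` of points such that `x` lies in the Heisenberg polydisc about `w`. -/
def nearPairs (m : ℕ) : Set (SPoint m × SPoint m) :=
  {x | heisInv x.1 x.2 ∈ polydisc m (srho x.1)}

end

@[simp] lemma heis_heisInv {m : ℕ} (w x : SPoint m) : heis w (heisInv w x) = x := by
  simp [heis, heisInv]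

@[simp] lemma heisInv_heis {m : ℕ} (w ζ : SPoint m) : heisInv w (heis w ζ) = ζ := by
  simp [heis, heisInv]

lemma heis_zero {m : ℕ} (w : SPoint m) : heis w 0 = w := by
  simp [heis]

lemma differentiable_heis {m : ℕ} (w : SPoint m) : Differentiable ℂ (heis w) := by
  unfold heis
  fun_prop

lemma isOpen_polydisc (m : ℕ) (r : ℝ) : IsOpen (polydisc m r) :=
  IsOpen.and (isOpen_lt (by fun_prop) (by fun_prop)) (isOpen_lt (by fun_prop) (by fun_prop))

lemma isOpen_nearPairs (m : ℕ) : IsOpen (nearPairs m) := by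
  have h := continuous_srho (m := m)
  simp only [nearPairs, polydisc, heisInv, Set.mem_ofPred_eq]
  exact IsOpen.and (isOpen_lt (by fun_prop) (by fun_prop)) (isOpen_lt (by fun_prop) (by fun_prop))

lemma smul_mem_polydisc {m : ℕ} {r : ℝ} {ζ : SPoint m} (hζ : ζ ∈ polydisc m r) {c : ℂ}
    (hc : ‖c‖ ≤ 1) : c • ζ ∈ polydisc m r := by
  refine ⟨lt_of_le_of_lt ?_ hζ.1, lt_of_le_of_lt ?_ hζ.2⟩
  · simp only [Prod.smul_fst, norm_smul]
    gcongr
    exact mul_le_of_le_one_left (norm_nonneg _) hc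
  · simp only [Prod.smul_snd, norm_smul]
    exact mul_le_of_le_one_left (norm_nonneg _) hc

lemma srho_heis {m : ℕ} (w ζ : SPoint m) :
    srho (heis w ζ) = srho w + ζ.2.im - ∑ j, ‖ζ.1 j‖ ^ 2 := by
  have h : ∀ j, ‖ζ.1 j + w.1 j‖ ^ 2 =
      ‖ζ.1 j‖ ^ 2 + ‖w.1 j‖ ^ 2 + 2 * (ζ.1 j * (starRingEnd ℂ) (w.1 j)).re := by
    intro j
    simp only [Complex.sq_norm, Complex.normSq_apply, Complex.mul_re, Complex.conj_re,
      Complex.conj_im, Complex.add_re, Complex.add_im]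
    ring
  simp only [srho, heis, Pi.add_apply, h, Finset.sum_add_distrib, ← Finset.mul_sum,
    ← Complex.re_sum]
  simp [Complex.mul_im]
  ring

lemma srho2_heis {m : ℕ} (z w ζ : SPoint m) :
    srho2 z (heis w ζ) = srho2 z w -
      ∑ j, (z.1 j - w.1 j) * (starRingEnd ℂ) (ζ.1 j)
        + Complex.I / 2 * (starRingEnd ℂ) ζ.2 := by
  simp only [srho2, heis, map_add, map_mul, map_sum, Complex.conj_conj, Complex.conj_I,
    Pi.add_apply, mul_add, sub_mul, Finset.sum_add_distrib, Finset.sum_sub_distrib, map_ofNat]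
  rw [Finset.sum_congr rfl (fun j _ => mul_comm (w.1 j) ((starRingEnd ℂ) (ζ.1 j)))]
  ring_nf
  simp

lemma polydisc_sum_le {m : ℕ} {r : ℝ} {ζ : SPoint m} (hζ : ζ ∈ polydisc m r) :
    ∑ j, ‖ζ.1 j‖ ^ 2 + ‖ζ.2‖ ≤ r / 4 := by
  have h1 := hζ.1
  have h2 := hζ.2
  have h3 := sum_le_sq_norm ζ.1
  have h4 : (m : ℝ) * ‖ζ.1‖ ^ 2 ≤ m * (r / (4 * (m + 1))) := by gcongr
  have h5 : m * (r / (4 * (m + 1))) + r / (4 * (m + 1)) = r / 4 := by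
    field_simp
  linarith

lemma srho_heis_bounds {m : ℕ} {w ζ : SPoint m} (hζ : ζ ∈ polydisc m (srho w)) :
    srho w ≤ 2 * srho (heis w ζ) ∧ srho (heis w ζ) ≤ 2 * srho w := by
  have h1 := polydisc_sum_le hζ
  have h2 := abs_le.1 (Complex.abs_im_le_norm ζ.2)
  have h3 : 0 ≤ ∑ j, ‖ζ.1 j‖ ^ 2 := by positivity
  have h4 := norm_nonneg ζ.2
  rw [srho_heis]
  constructor <;> linarith

lemma norm_srho2_heis_sub_le {m : ℕ} {z w ζ : SPoint m} (hz : z ∈ Siegel m)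
    (hw : w ∈ Siegel m) (hζ : ζ ∈ polydisc m (srho w)) :
    ‖srho2 z (heis w ζ) - srho2 z w‖ ≤ ‖srho2 z w‖ / 2 := by
  have hz' : 0 < srho z := hz
  have hw' : 0 < srho w := hw
  have h0 := le_norm_srho2 z w
  have h1 := polydisc_sum_le hζ
  have h2 : ‖∑ j, (z.1 j - w.1 j) * (starRingEnd ℂ) (ζ.1 j)‖ ≤
      (∑ j, ‖z.1 j - w.1 j‖ ^ 2) / 4 + ∑ j, ‖ζ.1 j‖ ^ 2 := by
    rw [Finset.sum_div, ← Finset.sum_add_distrib]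
    refine norm_sum_le_of_le _ fun j _ => ?_
    rw [norm_mul, RCLike.norm_conj]
    nlinarith [sq_nonneg (‖z.1 j - w.1 j‖ / 2 - ‖ζ.1 j‖)]
  have h3 : ‖Complex.I / 2 * (starRingEnd ℂ) ζ.2‖ = ‖ζ.2‖ / 2 := by
    simp
    ring
  have h4 := norm_nonneg ζ.2
  have h5 : srho2 z (heis w ζ) - srho2 z w =
      Complex.I / 2 * (starRingEnd ℂ) ζ.2 -
        ∑ j, (z.1 j - w.1 j) * (starRingEnd ℂ) (ζ.1 j) := by
    rw [srho2_heis]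
    ring
  rw [h5]
  refine (norm_sub_le _ _).trans ?_
  linarith

lemma norm_srho2_heis_le {m : ℕ} {z w ζ : SPoint m} (hz : z ∈ Siegel m)
    (hw : w ∈ Siegel m) (hζ : ζ ∈ polydisc m (srho w)) :
    ‖srho2 z (heis w ζ)‖ ≤ 2 * ‖srho2 z w‖ := by
  have h1 := norm_srho2_heis_sub_le hz hw hζ
  have h2 := norm_sub_norm_le (srho2 z (heis w ζ)) (srho2 z w)
  have h3 := norm_nonneg (srho2 z w)
  linarith

lemma le_norm_srho2_heis {m : ℕ} {z w ζ : SPoint m} (hz : z ∈ Siegel m)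
    (hw : w ∈ Siegel m) (hζ : ζ ∈ polydisc m (srho w)) :
    ‖srho2 z w‖ ≤ 2 * ‖srho2 z (heis w ζ)‖ := by
  have h1 := norm_srho2_heis_sub_le hz hw hζ
  have h2 := norm_sub_norm_le (srho2 z w) (srho2 z (heis w ζ))
  rw [norm_sub_rev] at h2
  linarith

lemma heis_mem_siegel {m : ℕ} {w ζ : SPoint m} (hw : w ∈ Siegel m)
    (hζ : ζ ∈ polydisc m (srho w)) : heis w ζ ∈ Siegel m := by
  have h := (srho_heis_bounds hζ).1
  have hw' : 0 < srho w := hw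
  change 0 < srho (heis w ζ)
  linarith

lemma measurePreserving_heis {m : ℕ} (w : SPoint m) : MeasurePreserving (heis w) := by
  refine MeasurePreserving.skew_product (f := fun x : Fin m → ℂ => x + w.1)
    (g := fun x y => y + (w.2 + 2 * Complex.I * ∑ j, x j * (starRingEnd ℂ) (w.1 j)))
    (measurePreserving_add_right _ _) (by fun_prop) ?_
  exact ae_of_all _ fun x => (measurePreserving_add_right _ _).map_eq

lemma measurableEmbedding_heis {m : ℕ} (w : SPoint m) : MeasurableEmbedding (heis w) := by
  refine Topology.IsClosedEmbedding.measurableEmbedding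
    (Homeomorph.isClosedEmbedding ⟨⟨heis w, heisInv w, heisInv_heis w, heis_heisInv w⟩, ?_, ?_⟩)
  · exact (differentiable_heis w).continuous
  · change Continuous fun x => heisInv w x
    simp only [heisInv]
    fun_prop

lemma lintegral_eq_lintegral_comp_smul {E : Type*} [NormedAddCommGroup E] [NormedSpace ℝ E]
    [FiniteDimensional ℝ E] [MeasurableSpace E] [BorelSpace E] (ν : Measure E)
    [ν.IsAddHaarMeasure] {f : E → ENNReal} (hf : Measurable f) {r : ℝ} (hr : 0 < r) :
    ∫⁻ x, f x ∂ν = ENNReal.ofReal (r ^ Module.finrank ℝ E) * ∫⁻ x, f (r • x) ∂ν := by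
  have h1 : ∫⁻ x, f (r • x) ∂ν = ∫⁻ x, f x ∂(ν.map (r • ·)) :=
    (lintegral_map hf (by fun_prop)).symm
  have h2 : (0 : ℝ) < r ^ Module.finrank ℝ E := by positivity
  rw [h1, Measure.map_addHaar_smul ν hr.ne', lintegral_smul_measure, smul_eq_mul, ← mul_assoc,
    ← ENNReal.ofReal_mul h2.le, abs_of_pos (inv_pos.2 h2), mul_inv_cancel₀ h2.ne',
    ENNReal.ofReal_one, one_mul]

/-- Scaling of `∫ (y + ‖x‖²)^{-(m + δ)} dx` over `ℂᵐ`. -/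
lemma lintegral_add_sq_norm_rpow (m : ℕ) {δ : ℝ} (hδ : 0 < δ) :
    ∃ C : ENNReal, C ≠ ⊤ ∧ ∀ y : ℝ, 0 < y →
      ∫⁻ x : Fin m → ℂ, ENNReal.ofReal ((y + ‖x‖ ^ 2) ^ (-(m + δ))) =
        ENNReal.ofReal (y ^ (-δ)) * C := by
  have hfin : Module.finrank ℝ (Fin m → ℂ) = 2 * m := by
    simp [Module.finrank_pi_fintype, mul_comm]
  refine ⟨∫⁻ x : Fin m → ℂ, ENNReal.ofReal ((1 + ‖x‖ ^ 2) ^ (-(m + δ))), ?_, fun y hy => ?_⟩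
  · have h := integrable_rpow_neg_one_add_norm_sq (E := Fin m → ℂ) (μ := volume)
      (r := 2 * (m + δ)) (by rw [hfin]; push_cast; linarith)
    have e : -(2 * (m + δ)) / 2 = -(m + δ) := by ring
    rw [e] at h
    exact h.lintegral_lt_top.ne
  · rw [lintegral_eq_lintegral_comp_smul volume (by fun_prop) (Real.sqrt_pos.2 hy), hfin, pow_mul,
      Real.sq_sqrt hy.le]
    have h : ∀ x : Fin m → ℂ, ENNReal.ofReal ((y + ‖√y • x‖ ^ 2) ^ (-(m + δ))) =
        ENNReal.ofReal (y ^ (-(m + δ))) * ENNReal.ofReal ((1 + ‖x‖ ^ 2) ^ (-(m + δ))) := by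
      intro x
      rw [← ENNReal.ofReal_mul (by positivity), ← Real.mul_rpow hy.le (by positivity), norm_smul,
        mul_pow, Real.norm_of_nonneg (Real.sqrt_nonneg y), Real.sq_sqrt hy.le]
      ring_nf
    simp_rw [h]
    rw [lintegral_const_mul _ (by fun_prop), ← mul_assoc, ← ENNReal.ofReal_mul (by positivity),
      ← Real.rpow_natCast, ← Real.rpow_add hy]
    ring_nf

lemma lintegral_Ioi_rpow_mul_one_add_rpow {t δ : ℝ} (ht : -1 < t) (hδ : 0 < δ) :
    ∫⁻ v in Set.Ioi (0 : ℝ), ENNReal.ofReal (v ^ t * (1 + v) ^ (-(1 + t + δ))) ≠ ⊤ := by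
  rw [← Set.Ioc_union_Ioi_eq_Ioi zero_le_one]
  refine ((lintegral_union_le _ _ _).trans_lt (ENNReal.add_lt_top.2 ⟨?_, ?_⟩)).ne
  · have h := (intervalIntegral.intervalIntegrable_rpow' (a := 0) (b := 1) ht)
    rw [intervalIntegrable_iff_integrableOn_Ioc_of_le zero_le_one] at h
    refine lt_of_le_of_lt (setLIntegral_mono' measurableSet_Ioc fun v hv => ?_) h.lintegral_lt_top
    have hv0 : 0 < v := hv.1
    refine ENNReal.ofReal_le_ofReal (mul_le_of_le_one_right (by positivity) ?_)
    exact Real.rpow_le_one_of_one_le_of_nonpos (by linarith) (by linarith)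
  · have h := integrableOn_Ioi_rpow_of_lt (a := -(1 + δ)) (c := 1) (by linarith) zero_lt_one
    refine lt_of_le_of_lt (setLIntegral_mono' measurableSet_Ioi fun v hv => ?_) h.lintegral_lt_top
    have hv0 : 0 < v := zero_lt_one.trans hv
    refine ENNReal.ofReal_le_ofReal ?_
    have e : -(1 + δ) = t + -(1 + t + δ) := by ring
    rw [e, Real.rpow_add hv0]
    gcongr ?_ * ?_
    exact Real.rpow_le_rpow_of_nonpos hv0 (by linarith) (by linarith)

/-- Scaling of `∫ v^t (y + v)^{-(1 + t + δ)} (y + |u|)^{-(1 + δ)} du dv` over the half-plane. -/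
lemma lintegral_halfPlane {t δ : ℝ} (ht : -1 < t) (hδ : 0 < δ) :
    ∃ C : ENNReal, C ≠ ⊤ ∧ ∀ y : ℝ, 0 < y →
      ∫⁻ ζ : ℂ, (Set.Ioi (0 : ℝ)).indicator
          (fun v => ENNReal.ofReal (v ^ t * (y + v) ^ (-(1 + t + δ)))) ζ.im *
          ENNReal.ofReal ((y + |ζ.re|) ^ (-(1 + δ))) =
        ENNReal.ofReal (y ^ (-(2 * δ))) * C := by
  have hm : ∀ y : ℝ, Measurable ((Set.Ioi (0 : ℝ)).indicator
      (fun v => ENNReal.ofReal (v ^ t * (y + v) ^ (-(1 + t + δ))))) := fun y =>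
    Measurable.indicator (by fun_prop) measurableSet_Ioi
  have hm' : ∀ y : ℝ, Measurable fun ζ : ℂ => (Set.Ioi (0 : ℝ)).indicator
      (fun v => ENNReal.ofReal (v ^ t * (y + v) ^ (-(1 + t + δ)))) ζ.im *
      ENNReal.ofReal ((y + |ζ.re|) ^ (-(1 + δ))) := fun y =>
    ((hm y).comp Complex.measurable_im).mul (by fun_prop)
  refine ⟨∫⁻ ζ : ℂ, (Set.Ioi (0 : ℝ)).indicator
          (fun v => ENNReal.ofReal (v ^ t * (1 + v) ^ (-(1 + t + δ)))) ζ.im *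
          ENNReal.ofReal ((1 + |ζ.re|) ^ (-(1 + δ))), ?_, fun y hy => ?_⟩
  · have h := Complex.volume_preserving_equiv_real_prod.lintegral_comp_emb
      Complex.measurableEquivRealProd.measurableEmbedding
      (fun x : ℝ × ℝ => ENNReal.ofReal ((1 + |x.1|) ^ (-(1 + δ))) * (Set.Ioi (0 : ℝ)).indicator
          (fun v => ENNReal.ofReal (v ^ t * (1 + v) ^ (-(1 + t + δ)))) x.2)
    simp only [Complex.measurableEquivRealProd_apply] at h
    simp_rw [mul_comm ((Set.Ioi (0 : ℝ)).indicator _ _)]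
    rw [h, Measure.volume_eq_prod, lintegral_prod_mul
        (f := fun u : ℝ => ENNReal.ofReal ((1 + |u|) ^ (-(1 + δ)))) (by fun_prop)
        (hm 1).aemeasurable,
      lintegral_indicator measurableSet_Ioi]
    have h2 := integrable_one_add_norm (E := ℝ) (μ := volume) (r := 1 + δ) (by simpa using hδ)
    exact ENNReal.mul_ne_top h2.lintegral_lt_top.ne (lintegral_Ioi_rpow_mul_one_add_rpow ht hδ)
  · rw [lintegral_eq_lintegral_comp_smul volume (hm' y) hy, Complex.finrank_real_complex]
    have h : ∀ ζ : ℂ, (Set.Ioi (0 : ℝ)).indicator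
          (fun v => ENNReal.ofReal (v ^ t * (y + v) ^ (-(1 + t + δ)))) (y • ζ).im *
          ENNReal.ofReal ((y + |(y • ζ).re|) ^ (-(1 + δ))) =
        ENNReal.ofReal (y ^ (-(2 + 2 * δ))) * ((Set.Ioi (0 : ℝ)).indicator
          (fun v => ENNReal.ofReal (v ^ t * (1 + v) ^ (-(1 + t + δ)))) ζ.im *
          ENNReal.ofReal ((1 + |ζ.re|) ^ (-(1 + δ)))) := by
      intro ζ
      simp only [Complex.smul_im, Complex.smul_re, smul_eq_mul]
      by_cases hζ : 0 < ζ.im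
      · rw [Set.indicator_of_mem (show y * ζ.im ∈ Set.Ioi 0 from mul_pos hy hζ),
          Set.indicator_of_mem (show ζ.im ∈ Set.Ioi 0 from hζ),
          ← ENNReal.ofReal_mul (by positivity), ← ENNReal.ofReal_mul (by positivity),
          ← ENNReal.ofReal_mul (by positivity), abs_mul, abs_of_pos hy,
          show y + y * ζ.im = y * (1 + ζ.im) by ring,
          show y + y * |ζ.re| = y * (1 + |ζ.re|) by ring,
          Real.mul_rpow hy.le hζ.le, Real.mul_rpow hy.le (by positivity),
          Real.mul_rpow hy.le (by positivity),
          show -(2 + 2 * δ) = t + -(1 + t + δ) + -(1 + δ) by ring,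
          Real.rpow_add hy, Real.rpow_add hy]
        ring_nf
      · rw [Set.indicator_of_notMem (show ¬ y * ζ.im ∈ Set.Ioi 0 from
            fun h => hζ (pos_of_mul_pos_right h hy.le)),
          Set.indicator_of_notMem (show ¬ ζ.im ∈ Set.Ioi 0 from hζ)]
        simp
    simp_rw [h]
    rw [lintegral_const_mul _ (hm' 1), ← mul_assoc, ← ENNReal.ofReal_mul (by positivity),
      ← Real.rpow_natCast, ← Real.rpow_add hy]
    congr 3
    push_cast
    ring

lemma srho2_rpow_neg_le {m : ℕ} {t δ : ℝ} (ht : -1 < t) (hδ : 0 < δ) {z w : SPoint m}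
    (hz : z ∈ Siegel m) (hw : w ∈ Siegel m) :
    ‖srho2 z w‖ ^ (-(m + 2 + t + 3 * δ)) ≤ 4 ^ (m + 2 + t + 3 * δ) *
      ((srho z + srho w) ^ (-(1 + t + δ)) *
        (srho z + |w.2.re - (z.2.re + 2 * (∑ j, z.1 j * (starRingEnd ℂ) (w.1 j)).im)|)
          ^ (-(1 + δ)) *
        (srho z + ‖w.1 - z.1‖ ^ 2) ^ (-(m + δ))) := by
  have hz' : 0 < srho z := hz
  have hw' : 0 < srho w := hw
  have hR := norm_srho2_pos hz hw
  have h0 := le_norm_srho2 z w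
  have h1 : ‖w.1 - z.1‖ ^ 2 ≤ ∑ j, ‖z.1 j - w.1 j‖ ^ 2 := by
    rw [norm_sub_rev]
    exact sq_norm_le_sum (z.1 - w.1)
  have h2 := Complex.abs_im_le_norm (srho2 z w)
  rw [srho2_im] at h2
  have h3 : |w.2.re - (z.2.re + 2 * (∑ j, z.1 j * (starRingEnd ℂ) (w.1 j)).im)| =
      2 * |(w.2.re - z.2.re) / 2 - (∑ j, z.1 j * (starRingEnd ℂ) (w.1 j)).im| := by
    rw [← abs_two (α := ℝ), ← abs_mul, abs_two]
    congr 1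
    ring
  have h4 : 0 ≤ ‖w.1 - z.1‖ ^ 2 := by positivity
  set u := |w.2.re - (z.2.re + 2 * (∑ j, z.1 j * (starRingEnd ℂ) (w.1 j)).im)|
  have hu : 0 ≤ u := abs_nonneg _
  have e : ‖srho2 z w‖ ^ (-(m + 2 + t + 3 * δ)) = 4 ^ (m + 2 + t + 3 * δ) *
      ((4 * ‖srho2 z w‖) ^ (-(1 + t + δ)) * (4 * ‖srho2 z w‖) ^ (-(1 + δ)) *
        (4 * ‖srho2 z w‖) ^ (-(m + δ))) := by
    rw [← Real.rpow_add (by positivity), ← Real.rpow_add (by positivity),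
      show -(1 + t + δ) + -(1 + δ) + -(m + δ) = -(m + 2 + t + 3 * δ) by ring,
      Real.mul_rpow (by positivity) (by positivity), ← mul_assoc,
      ← Real.rpow_add (by positivity)]
    simp
  have hm : (0 : ℝ) ≤ m := by positivity
  rw [e]
  gcongr ?_ * (?_ * ?_ * ?_)
  · exact Real.rpow_le_rpow_of_nonpos (by linarith) (by linarith) (by linarith)
  · exact Real.rpow_le_rpow_of_nonpos (by linarith) (by linarith) (by linarith)
  · exact Real.rpow_le_rpow_of_nonpos (by linarith) (by linarith) (by linarith)

/-- The Forelli–Rudin estimate on the Siegel half-space. -/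
theorem forelli_rudin (m : ℕ) {t N : ℝ} (ht : -1 < t) (hN : m + 2 + t < N) :
    ∃ C : ENNReal, C ≠ ⊤ ∧ ∀ z ∈ Siegel m,
      ∫⁻ w in Siegel m, ENNReal.ofReal (srho w ^ t * ‖srho2 z w‖ ^ (-N)) ≤
        C * ENNReal.ofReal (srho z ^ (m + 2 + t - N)) := by
  obtain ⟨δ, hδ, rfl⟩ : ∃ δ : ℝ, 0 < δ ∧ N = m + 2 + t + 3 * δ :=
    ⟨(N - (m + 2 + t)) / 3, by linarith, by ring⟩
  obtain ⟨C₁, hC₁, h₁⟩ := lintegral_add_sq_norm_rpow m hδ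
  obtain ⟨C₂, hC₂, h₂⟩ := lintegral_halfPlane ht hδ
  refine ⟨ENNReal.ofReal (4 ^ (m + 2 + t + 3 * δ)) * (C₁ * C₂),
    ENNReal.mul_ne_top ENNReal.ofReal_ne_top (ENNReal.mul_ne_top hC₁ hC₂), fun z hz => ?_⟩
  have hy : 0 < srho z := hz
  set y := srho z with hydef
  let F : (Fin m → ℂ) → ENNReal := fun x => ENNReal.ofReal ((y + ‖x‖ ^ 2) ^ (-(m + δ)))
  let G : ℂ → ENNReal := fun ζ => (Set.Ioi (0 : ℝ)).indicator
          (fun v => ENNReal.ofReal (v ^ t * (y + v) ^ (-(1 + t + δ)))) ζ.im *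
          ENNReal.ofReal ((y + |ζ.re|) ^ (-(1 + δ)))
  let s : (Fin m → ℂ) → ℂ := fun x =>
    ⟨z.2.re + 2 * (∑ j, z.1 j * (starRingEnd ℂ) (x j)).im, ∑ j, ‖x j‖ ^ 2⟩
  have hF : Measurable F := by fun_prop
  have hG : Measurable G := Measurable.mul
    ((Measurable.indicator (by fun_prop) measurableSet_Ioi).comp Complex.measurable_im)
    (by fun_prop)
  have hs : Measurable s := by
    have : s = fun x => ((z.2.re + 2 * (∑ j, z.1 j * (starRingEnd ℂ) (x j)).im : ℝ) : ℂ) +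
        ((∑ j, ‖x j‖ ^ 2 : ℝ) : ℂ) * Complex.I := by
      funext x
      exact Complex.mk_eq_add_mul_I _ _
    rw [this]
    fun_prop
  have hpt : ∀ w ∈ Siegel m,
      ENNReal.ofReal (srho w ^ t * ‖srho2 z w‖ ^ (-(m + 2 + t + 3 * δ))) ≤
        ENNReal.ofReal (4 ^ (m + 2 + t + 3 * δ)) * (F (w.1 - z.1) * G (w.2 - s w.1)) := by
    intro w hw
    have hw' : 0 < srho w := hw
    have him : (w.2 - s w.1).im = srho w := rfl
    have hre : (w.2 - s w.1).re =
      w.2.re - (z.2.re + 2 * (∑ j, z.1 j * (starRingEnd ℂ) (w.1 j)).im) := rfl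
    simp only [F, G, him, hre]
    rw [Set.indicator_of_mem (show srho w ∈ Set.Ioi 0 from hw'),
      ← ENNReal.ofReal_mul (by positivity), ← ENNReal.ofReal_mul (by positivity),
      ← ENNReal.ofReal_mul (by positivity)]
    refine ENNReal.ofReal_le_ofReal ?_
    have := mul_le_mul_of_nonneg_left (srho2_rpow_neg_le ht hδ hz hw)
      (Real.rpow_nonneg hw'.le t)
    refine this.trans (le_of_eq ?_)
    ring
  calc _ ≤ ∫⁻ w in Siegel m, ENNReal.ofReal (4 ^ (m + 2 + t + 3 * δ)) *
          (F (w.1 - z.1) * G (w.2 - s w.1)) :=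
        setLIntegral_mono' (measurableSet_siegel m) hpt
    _ ≤ ∫⁻ w : SPoint m, ENNReal.ofReal (4 ^ (m + 2 + t + 3 * δ)) *
          (F (w.1 - z.1) * G (w.2 - s w.1)) := setLIntegral_le_lintegral _ _
    _ = ENNReal.ofReal (4 ^ (m + 2 + t + 3 * δ)) *
          ∫⁻ x : Fin m → ℂ, ∫⁻ ζ : ℂ, F (x - z.1) * G (ζ - s x) := by
        rw [lintegral_const_mul _ (by fun_prop), Measure.volume_eq_prod,
          lintegral_prod _ (by fun_prop)]
    _ = ENNReal.ofReal (4 ^ (m + 2 + t + 3 * δ)) *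
          ((∫⁻ x : Fin m → ℂ, F x) * ∫⁻ ζ : ℂ, G ζ) := by
        congr 1
        have h : ∀ x : Fin m → ℂ, ∫⁻ ζ : ℂ, F (x - z.1) * G (ζ - s x) =
            F (x - z.1) * ∫⁻ ζ : ℂ, G ζ := fun x => by
          rw [lintegral_const_mul _ (by fun_prop), lintegral_sub_right_eq_self G (s x)]
        simp_rw [h]
        rw [lintegral_mul_const _ (by fun_prop), lintegral_sub_right_eq_self F z.1]
    _ = _ := by
        simp only [F, G]
        rw [h₁ y hy, h₂ y hy,
          show (m : ℝ) + 2 + t - (m + 2 + t + 3 * δ) = -δ + -(2 * δ) by ring,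
          Real.rpow_add hy, ENNReal.ofReal_mul (by positivity)]
        ring

lemma measurePreserving_smul_of_norm_eq_one {m : ℕ} {c : ℂ} (hc : ‖c‖ = 1) :
    MeasurePreserving (fun ζ : SPoint m => c • ζ) := by
  have h : MeasurePreserving (fun x : ℂ => c • x) := by
    have := (rotation ⟨c, by simpa [Submonoid.unitSphere] using hc⟩).measurePreserving
    exact this
  exact (volume_preserving_pi (fun _ : Fin m => h)).prod h

/-- The mean value inequality on the unit circle. -/
lemma enorm_le_lintegral_circle {g : ℂ → ℂ} {U : Set ℂ}
    (hsub : Metric.closedBall 0 1 ⊆ U) (hg : DifferentiableOn ℂ g U) :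
    ENNReal.ofReal (2 * Real.pi) * ‖g 0‖ₑ ≤
      ∫⁻ θ in Set.Ioc 0 (2 * Real.pi), ‖g (circleMap 0 1 θ)‖ₑ := by
  have h1 : DiffContOnCl ℂ g (Metric.ball 0 |1|) := by
    rw [abs_one]
    exact (hg.mono (by rwa [closure_ball _ one_ne_zero])).diffContOnCl
  have h2 := h1.circleAverage
  rw [Real.circleAverage] at h2
  have h3 : (2 * Real.pi) • g 0 = ∫ θ in Set.Ioc 0 (2 * Real.pi), g (circleMap 0 1 θ) := by
    rw [← h2, smul_smul, mul_inv_cancel₀ (by positivity), one_smul,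
      intervalIntegral.integral_of_le (by positivity)]
  calc _ = ‖(2 * Real.pi) • g 0‖ₑ := by
        rw [enorm_smul, Real.enorm_of_nonneg (by positivity)]
    _ ≤ _ := by
        rw [h3]
        exact enorm_integral_le_lintegral_enorm _

/-- The sub-mean value property over a circled open set. -/
lemma enorm_mul_volume_le {m : ℕ} {P : Set (SPoint m)} (hP : IsOpen P)
    (hbal : ∀ ζ ∈ P, ∀ c : ℂ, ‖c‖ ≤ 1 → c • ζ ∈ P) {g : SPoint m → ℂ}
    (hg : DifferentiableOn ℂ g P) :
    ‖g 0‖ₑ * volume P ≤ ∫⁻ ζ in P, ‖g ζ‖ₑ := by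
  set G : SPoint m → ENNReal := P.indicator fun ζ => ‖g ζ‖ₑ with hGdef
  have hG : Measurable G := by
    classical
    have : Measurable (P.piecewise g fun _ => 0) :=
      hg.continuousOn.measurable_piecewise continuousOn_const hP.measurableSet
    convert this.enorm using 1
    funext ζ
    by_cases hζ : ζ ∈ P <;> simp [hGdef, hζ]
  have hinner : ∀ ζ ∈ P, ENNReal.ofReal (2 * Real.pi) * ‖g 0‖ₑ ≤
      ∫⁻ θ in Set.Ioc 0 (2 * Real.pi), G (circleMap 0 1 θ • ζ) := by
    intro ζ hζ
    have hsm : Differentiable ℂ fun c : ℂ => c • ζ := by fun_prop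
    have h := enorm_le_lintegral_circle (g := fun c : ℂ => g (c • ζ))
      (U := (fun c : ℂ => c • ζ) ⁻¹' P)
      (fun c hc => hbal ζ hζ c (by simpa using hc))
      (hg.comp hsm.differentiableOn (Set.mapsTo_preimage _ _))
    rw [zero_smul] at h
    refine h.trans (lintegral_mono fun θ => ?_)
    rw [hGdef, Set.indicator_of_mem (hbal ζ hζ _ (by simp))]
  have hpi : ENNReal.ofReal (2 * Real.pi) ≠ 0 := by
    simpa using Real.pi_pos
  refine (ENNReal.mul_le_mul_iff_right hpi ENNReal.ofReal_ne_top).1 ?_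
  calc ENNReal.ofReal (2 * Real.pi) * (‖g 0‖ₑ * volume P)
      = ∫⁻ _ζ in P, ENNReal.ofReal (2 * Real.pi) * ‖g 0‖ₑ := by
        rw [setLIntegral_const, mul_assoc]
    _ ≤ ∫⁻ ζ in P, ∫⁻ θ in Set.Ioc 0 (2 * Real.pi), G (circleMap 0 1 θ • ζ) :=
        setLIntegral_mono' hP.measurableSet hinner
    _ ≤ ∫⁻ ζ : SPoint m, ∫⁻ θ in Set.Ioc 0 (2 * Real.pi), G (circleMap 0 1 θ • ζ) :=
        setLIntegral_le_lintegral _ _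
    _ = ∫⁻ θ in Set.Ioc 0 (2 * Real.pi), ∫⁻ ζ : SPoint m, G (circleMap 0 1 θ • ζ) := by
        refine lintegral_lintegral_swap (Measurable.aemeasurable ?_)
        refine hG.comp ?_
        have := continuous_circleMap 0 1
        exact Continuous.measurable (by fun_prop)
    _ = ∫⁻ _θ in Set.Ioc 0 (2 * Real.pi), ∫⁻ ζ in P, ‖g ζ‖ₑ := by
        refine lintegral_congr fun θ => ?_
        rw [(measurePreserving_smul_of_norm_eq_one (by simp)).lintegral_comp hG,
          lintegral_indicator hP.measurableSet]
    _ = _ := by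
        rw [setLIntegral_const, Real.volume_Ioc, sub_zero, mul_comm]

lemma volume_polydisc (m : ℕ) : ∃ c : ENNReal, c ≠ 0 ∧ c ≠ ⊤ ∧ ∀ r : ℝ, 0 < r →
    volume (polydisc m r) = c * ENNReal.ofReal (r ^ ((m : ℝ) + 2)) := by
  set ε : ℝ := 1 / (4 * (m + 1)) with hε
  have hε0 : 0 < ε := by positivity
  have hfin : Module.finrank ℝ (Fin m → ℂ) = 2 * m := by
    simp [Module.finrank_pi_fintype, mul_comm]
  refine ⟨ENNReal.ofReal (ε ^ (m + 2)) * (volume (Metric.ball (0 : Fin m → ℂ) 1) *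
    volume (Metric.ball (0 : ℂ) 1)), ?_, ?_, fun r hr => ?_⟩
  · refine mul_ne_zero (by simpa using pow_pos hε0 _) (mul_ne_zero ?_ ?_)
    · exact (Metric.measure_ball_pos _ _ one_pos).ne'
    · exact (Metric.measure_ball_pos _ _ one_pos).ne'
  · exact ENNReal.mul_ne_top ENNReal.ofReal_ne_top
      (ENNReal.mul_ne_top measure_ball_lt_top.ne measure_ball_lt_top.ne)
  · have hset : polydisc m r = Metric.ball (0 : Fin m → ℂ) (√(ε * r)) ×ˢ
        Metric.ball (0 : ℂ) (ε * r) := by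
      ext ζ
      have e : r / (4 * (m + 1)) = ε * r := by rw [hε]; ring
      simp only [polydisc, Set.mem_ofPred_eq, Set.mem_prod, mem_ball_zero_iff, e]
      rw [Real.lt_sqrt (norm_nonneg _)]
    rw [hset, Measure.volume_eq_prod, Measure.prod_prod,
      Measure.addHaar_ball_of_pos _ _ (Real.sqrt_pos.2 (mul_pos hε0 hr)),
      Measure.addHaar_ball_of_pos _ (0 : ℂ) (mul_pos hε0 hr), hfin, pow_mul,
      Real.sq_sqrt (by positivity), Complex.finrank_real_complex]
    have : r ^ ((m : ℝ) + 2) = r ^ (m + 2) := by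
      rw [← Real.rpow_natCast]
      push_cast
      rfl
    rw [this]
    calc _ = (ENNReal.ofReal ((ε * r) ^ m) * ENNReal.ofReal ((ε * r) ^ 2)) *
          (volume (Metric.ball (0 : Fin m → ℂ) 1) * volume (Metric.ball (0 : ℂ) 1)) := by ring
      _ = (ENNReal.ofReal (ε ^ (m + 2)) * ENNReal.ofReal (r ^ (m + 2))) *
          (volume (Metric.ball (0 : Fin m → ℂ) 1) * volume (Metric.ball (0 : ℂ) 1)) := by
        rw [← ENNReal.ofReal_mul (by positivity), ← ENNReal.ofReal_mul (by positivity)]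
        ring_nf
      _ = _ := by ring

/-- A holomorphic function at `w` is dominated by its average over the Heisenberg polydisc
about `w`. -/
lemma enorm_le_average (m : ℕ) : ∃ c : ENNReal, c ≠ ⊤ ∧
    ∀ f : SPoint m → ℂ, DifferentiableOn ℂ f (Siegel m) → ∀ w ∈ Siegel m,
      ‖f w‖ₑ ≤ c * ENNReal.ofReal (srho w ^ (-((m : ℝ) + 2))) *
        ∫⁻ x, (nearPairs m).indicator (fun x => ‖f x.2‖ₑ) (w, x) := by
  obtain ⟨c, hc0, hct, hc⟩ := volume_polydisc m
  refine ⟨c⁻¹, ENNReal.inv_ne_top.2 hc0, fun f hf w hw => ?_⟩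
  have hw' : 0 < srho w := hw
  have hvol := hc _ hw'
  have h := enorm_mul_volume_le (isOpen_polydisc m (srho w))
    (fun ζ hζ _ hc => smul_mem_polydisc hζ hc) (g := fun ζ => f (heis w ζ))
    (hf.comp (differentiable_heis w).differentiableOn fun ζ hζ => heis_mem_siegel hw hζ)
  rw [heis_zero, hvol] at h
  have hInt : ∫⁻ ζ in polydisc m (srho w), ‖f (heis w ζ)‖ₑ =
      ∫⁻ x, (nearPairs m).indicator (fun x => ‖f x.2‖ₑ) (w, x) := by
    rw [← (measurePreserving_heis w).lintegral_comp_emb (measurableEmbedding_heis w),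
      ← lintegral_indicator (isOpen_polydisc m (srho w)).measurableSet]
    refine lintegral_congr fun ζ => ?_
    by_cases hζ : ζ ∈ polydisc m (srho w)
    · rw [Set.indicator_of_mem hζ, Set.indicator_of_mem]
      simpa [nearPairs] using hζ
    · rw [Set.indicator_of_notMem hζ, Set.indicator_of_notMem]
      simpa [nearPairs] using hζ
  rw [hInt] at h
  have hr : (0 : ℝ) < srho w ^ ((m : ℝ) + 2) := by positivity
  calc ‖f w‖ₑ = c⁻¹ * ENNReal.ofReal (srho w ^ (-((m : ℝ) + 2))) *
        (‖f w‖ₑ * (c * ENNReal.ofReal (srho w ^ ((m : ℝ) + 2)))) := by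
        rw [Real.rpow_neg hw'.le, ENNReal.ofReal_inv_of_pos hr]
        have h1 := ENNReal.inv_mul_cancel hc0 hct
        have h2 := ENNReal.inv_mul_cancel (ENNReal.ofReal_pos.2 hr).ne' ENNReal.ofReal_ne_top
        calc ‖f w‖ₑ = (c⁻¹ * c) * ((ENNReal.ofReal (srho w ^ ((m : ℝ) + 2)))⁻¹ *
              ENNReal.ofReal (srho w ^ ((m : ℝ) + 2))) * ‖f w‖ₑ := by rw [h1, h2]; simp
          _ = _ := by ring
    _ ≤ _ := by gcongr

/-- The Schur test. -/
lemma schur_test {X : Type*} [MeasurableSpace X] {ν : Measure X} [SFinite ν]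
    {k : X → X → ENNReal} (hk : Measurable (Function.uncurry k)) {p q : ℝ}
    (hpq : p.HolderConjugate q) {h : X → ENNReal} (hh : Measurable h)
    (h0 : ∀ᵐ x ∂ν, h x ≠ 0) (htop : ∀ᵐ x ∂ν, h x ≠ ⊤) {A : ENNReal}
    (h₁ : ∀ᵐ x ∂ν, ∫⁻ y, k x y * h y ^ q ∂ν ≤ A * h x ^ q)
    (h₂ : ∀ᵐ y ∂ν, ∫⁻ x, k x y * h x ^ p ∂ν ≤ A * h y ^ p)
    {f : X → ENNReal} (hf : Measurable f) :
    ∫⁻ x, (∫⁻ y, k x y * f y ∂ν) ^ p ∂ν ≤ A ^ (p / q) * A * ∫⁻ y, f y ^ p ∂ν := by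
  have hp := hpq.pos
  have hq := hpq.symm.pos
  have hkx : ∀ x, Measurable (k x) := fun x => hk.comp measurable_prodMk_left
  have hky : ∀ y, Measurable fun x => k x y := fun y => hk.comp measurable_prodMk_right
  have hstep : ∀ᵐ x ∂ν, (∫⁻ y, k x y * f y ∂ν) ^ p ≤
      A ^ (p / q) * ∫⁻ y, h x ^ p * (k x y * (f y / h y) ^ p) ∂ν := by
    filter_upwards [h₁] with x hx
    have e : ∫⁻ y, k x y * f y ∂ν =
        ∫⁻ y, ((fun y => k x y ^ (1 / p) * (f y / h y)) *
          (fun y => k x y ^ (1 / q) * h y)) y ∂ν := by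
      refine lintegral_congr_ae ?_
      filter_upwards [h0, htop] with y hy0 hyt
      have e1 : k x y = k x y ^ (1 / p) * k x y ^ (1 / q) := by
        rw [← ENNReal.rpow_add_of_nonneg _ _ (by positivity) (by positivity)]
        have := hpq.inv_add_inv_eq_one
        simp only [one_div, this, ENNReal.rpow_one]
      have e2 : f y = f y / h y * h y := (ENNReal.div_mul_cancel hy0 hyt).symm
      simp only [Pi.mul_apply]
      calc k x y * f y = (k x y ^ (1 / p) * k x y ^ (1 / q)) * (f y / h y * h y) := by
            rw [← e1, ← e2]
        _ = _ := by ring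
    have hH := ENNReal.lintegral_mul_le_Lp_mul_Lq ν hpq
      (f := fun y => k x y ^ (1 / p) * (f y / h y)) (g := fun y => k x y ^ (1 / q) * h y)
      ((((hkx x).pow_const _).mul (hf.div hh)).aemeasurable)
      ((((hkx x).pow_const _).mul hh).aemeasurable)
    rw [← e] at hH
    have hpow : ∀ (r : ℝ), 0 < r → ∀ a b : ENNReal, (a ^ (1 / r) * b) ^ r = a * b ^ r := by
      intro r hr a b
      rw [ENNReal.mul_rpow_of_nonneg _ _ hr.le, ← ENNReal.rpow_mul, one_div,
        inv_mul_cancel₀ hr.ne', ENNReal.rpow_one]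
    simp only [hpow p hp, hpow q hq] at hH
    calc (∫⁻ y, k x y * f y ∂ν) ^ p
        ≤ ((∫⁻ y, k x y * (f y / h y) ^ p ∂ν) ^ (1 / p) * (A * h x ^ q) ^ (1 / q)) ^ p := by
          gcongr
          exact hH.trans (by gcongr)
      _ = A ^ (p / q) * (h x ^ p * ∫⁻ y, k x y * (f y / h y) ^ p ∂ν) := by
          rw [hpow p hp, ENNReal.mul_rpow_of_nonneg _ _ (by positivity : 0 ≤ 1 / q),
            ENNReal.mul_rpow_of_nonneg _ _ hp.le, ← ENNReal.rpow_mul, ← ENNReal.rpow_mul,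
            ← ENNReal.rpow_mul, show q * (1 / q * p) = p by field_simp,
            show 1 / q * p = p / q by ring]
          ring
      _ = _ := by
          congr 1
          exact (lintegral_const_mul _ ((hkx x).mul ((hf.div hh).pow_const _))).symm
  have hmeas : Measurable (Function.uncurry fun x y => h x ^ p * (k x y * (f y / h y) ^ p)) :=
    ((hh.comp measurable_fst).pow_const _).mul
      (hk.mul (((hf.div hh).comp measurable_snd).pow_const _))
  calc ∫⁻ x, (∫⁻ y, k x y * f y ∂ν) ^ p ∂ν
      ≤ ∫⁻ x, A ^ (p / q) * ∫⁻ y, h x ^ p * (k x y * (f y / h y) ^ p) ∂ν ∂ν :=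
        lintegral_mono_ae hstep
    _ = A ^ (p / q) * ∫⁻ x, ∫⁻ y, h x ^ p * (k x y * (f y / h y) ^ p) ∂ν ∂ν :=
        lintegral_const_mul _ hmeas.lintegral_prod_right'
    _ = A ^ (p / q) * ∫⁻ y, ∫⁻ x, h x ^ p * (k x y * (f y / h y) ^ p) ∂ν ∂ν := by
        rw [lintegral_lintegral_swap hmeas.aemeasurable]
    _ ≤ A ^ (p / q) * ∫⁻ y, A * f y ^ p ∂ν := by
        refine mul_le_mul_right (lintegral_mono_ae ?_) _
        filter_upwards [h₂, h0, htop] with y hy hy0 hyt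
        calc ∫⁻ x, h x ^ p * (k x y * (f y / h y) ^ p) ∂ν
            = ∫⁻ x, (f y / h y) ^ p * (k x y * h x ^ p) ∂ν := by
              refine lintegral_congr fun x => ?_
              ring
          _ = (f y / h y) ^ p * ∫⁻ x, k x y * h x ^ p ∂ν :=
              lintegral_const_mul _ ((hky y).mul (hh.pow_const _))
          _ ≤ (f y / h y) ^ p * (A * h y ^ p) := by gcongr
          _ = A * (f y / h y * h y) ^ p := by
              rw [ENNReal.mul_rpow_of_nonneg _ _ hp.le]
              ring
          _ = A * f y ^ p := by rw [ENNReal.div_mul_cancel hy0 hyt]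
    _ = _ := by
        rw [lintegral_const_mul _ (hf.pow_const _), mul_assoc]

/-- The Carleson condition bounds the mass of the points whose polydisc contains `x`. -/
lemma carleson_measure_nearPairs_le {m : ℕ} {q : ℝ} (hq : 0 < q) {μ : Measure (SPoint m)} {C : ℝ}
    (hC : ∀ f : SPoint m → ℂ, DifferentiableOn ℂ f (Siegel m) →
      IntegrableOn (fun z => ‖f z‖ ^ q) (Siegel m) volume →
      ∫⁻ z in Siegel m, ENNReal.ofReal (‖f z‖ ^ q) ∂μ ≤
        ENNReal.ofReal C * ∫⁻ z in Siegel m, ENNReal.ofReal (‖f z‖ ^ q)) :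
    ∃ C' : ENNReal, C' ≠ ⊤ ∧ ∀ x ∈ Siegel m,
      (μ.restrict (Siegel m)) {w | (w, x) ∈ nearPairs m} ≤
        C' * ENNReal.ofReal (srho x ^ ((m : ℝ) + 2)) := by
  obtain ⟨k, hk⟩ := exists_nat_gt (((m : ℝ) + 2) / q)
  set N : ℝ := k * q with hNdef
  have hN : (m : ℝ) + 2 < N := (div_lt_iff₀ hq).1 hk
  obtain ⟨A, hA, hFR⟩ := forelli_rudin m (t := 0) (N := N) (by norm_num) (by simpa using hN)
  refine ⟨ENNReal.ofReal (4 ^ N) * (ENNReal.ofReal C * A),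
    ENNReal.mul_ne_top ENNReal.ofReal_ne_top (ENNReal.mul_ne_top ENNReal.ofReal_ne_top hA),
    fun x hx => ?_⟩
  have hx' : 0 < srho x := hx
  let f : SPoint m → ℂ := fun w => (srho2 w x ^ k)⁻¹
  have hfd : DifferentiableOn ℂ f (Siegel m) := by
    refine DifferentiableOn.inv ((differentiable_srho2 x).pow k).differentiableOn fun w hw => ?_
    exact pow_ne_zero _ (norm_pos_iff.1 (norm_srho2_pos hw hx))
  have hfn : ∀ w, ‖f w‖ ^ q = ‖srho2 x w‖ ^ (-N) := by
    intro w
    simp only [f, norm_inv, norm_pow]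
    rw [norm_srho2_comm, ← Real.rpow_natCast, ← Real.rpow_neg (norm_nonneg _),
      ← Real.rpow_mul (norm_nonneg _), hNdef, neg_mul]
  have hI : ∫⁻ w in Siegel m, ENNReal.ofReal (‖f w‖ ^ q) ≤
      A * ENNReal.ofReal (srho x ^ (m + 2 - N)) := by
    simpa [hfn] using hFR x hx
  have hfi : IntegrableOn (fun z => ‖f z‖ ^ q) (Siegel m) volume := by
    refine ⟨?_, ?_⟩
    · refine ContinuousOn.aestronglyMeasurable ?_ (measurableSet_siegel m)
      exact hfd.continuousOn.norm.rpow_const fun _ _ => Or.inr hq.le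
    · rw [hasFiniteIntegral_iff_ofReal (ae_of_all _ fun w => by positivity)]
      exact hI.trans_lt (ENNReal.mul_lt_top hA.lt_top ENNReal.ofReal_lt_top)
  have hmeas : MeasurableSet {w : SPoint m | (w, x) ∈ nearPairs m} :=
    measurable_prodMk_right (isOpen_nearPairs m).measurableSet
  have hlow : ∀ w ∈ Siegel m, (w, x) ∈ nearPairs m →
      ENNReal.ofReal ((4 * srho x) ^ (-N)) ≤ ENNReal.ofReal (‖f w‖ ^ q) := by
    intro w hw hn
    have h1 := norm_srho2_heis_le hw hw hn
    have h2 := (srho_heis_bounds hn).1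
    simp only [heis_heisInv] at h1 h2
    have hw' : 0 < srho w := hw
    rw [srho2_self, Complex.norm_real, Real.norm_of_nonneg hw'.le] at h1
    rw [hfn, norm_srho2_comm]
    refine ENNReal.ofReal_le_ofReal ?_
    refine Real.rpow_le_rpow_of_nonpos (norm_srho2_pos hw hx) (by linarith) ?_
    have : (0 : ℝ) ≤ m := by positivity
    linarith
  have hmain : ENNReal.ofReal ((4 * srho x) ^ (-N)) *
      (μ.restrict (Siegel m)) {w | (w, x) ∈ nearPairs m} ≤
        ENNReal.ofReal C * (A * ENNReal.ofReal (srho x ^ (m + 2 - N))) := by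
    calc _ = ∫⁻ w in Siegel m, {w | (w, x) ∈ nearPairs m}.indicator
            (fun _ => ENNReal.ofReal ((4 * srho x) ^ (-N))) w ∂μ := by
          rw [lintegral_indicator_const hmeas]
      _ ≤ ∫⁻ w in Siegel m, ENNReal.ofReal (‖f w‖ ^ q) ∂μ := by
          refine setLIntegral_mono' (measurableSet_siegel m) fun w hw => ?_
          by_cases hn : w ∈ {w : SPoint m | (w, x) ∈ nearPairs m}
          · rw [Set.indicator_of_mem hn]
            exact hlow w hw hn
          · rw [Set.indicator_of_notMem hn]
            exact zero_le
      _ ≤ _ := (hC f hfd hfi).trans (by gcongr)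
  have h4 : (0 : ℝ) < 4 * srho x := by positivity
  calc (μ.restrict (Siegel m)) {w | (w, x) ∈ nearPairs m}
      = ENNReal.ofReal ((4 * srho x) ^ N) * (ENNReal.ofReal ((4 * srho x) ^ (-N)) *
        (μ.restrict (Siegel m)) {w | (w, x) ∈ nearPairs m}) := by
        rw [← mul_assoc, ← ENNReal.ofReal_mul (by positivity), ← Real.rpow_add h4]
        simp
    _ ≤ ENNReal.ofReal ((4 * srho x) ^ N) *
        (ENNReal.ofReal C * (A * ENNReal.ofReal (srho x ^ (m + 2 - N)))) := by gcongr
    _ = ENNReal.ofReal (4 ^ N) * (ENNReal.ofReal C * A) *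
        (ENNReal.ofReal (srho x ^ N) * ENNReal.ofReal (srho x ^ (m + 2 - N))) := by
        rw [Real.mul_rpow (by norm_num) hx'.le, ENNReal.ofReal_mul (by positivity)]
        ring
    _ = _ := by
        rw [← ENNReal.ofReal_mul (by positivity), ← Real.rpow_add hx']
        ring_nf

lemma measurable_indicator_enorm {m : ℕ} {f : SPoint m → ℂ}
    (hf : DifferentiableOn ℂ f (Siegel m)) :
    Measurable ((Siegel m).indicator fun w => ‖f w‖ₑ) := by
  classical
  have : Measurable ((Siegel m).piecewise f fun _ => 0) :=
    hf.continuousOn.measurable_piecewise continuousOn_const (measurableSet_siegel m)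
  convert this.enorm using 1
  funext ζ
  by_cases hζ : ζ ∈ Siegel m <;> simp [hζ]

lemma measurable_srho2_rpow {m : ℕ} (s : ℝ) :
    Measurable fun x : SPoint m × SPoint m => ENNReal.ofReal (‖srho2 x.1 x.2‖ ^ s) := by
  have := (continuous_srho2 (m := m)).measurable
  fun_prop

lemma measurable_srho2_rpow_right {m : ℕ} (z : SPoint m) (s : ℝ) :
    Measurable fun x : SPoint m => ENNReal.ofReal (‖srho2 z x‖ ^ s) := by
  have h : Measurable fun x : SPoint m => srho2 z x :=
    (continuous_srho2.comp (Continuous.prodMk_right z)).measurable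
  fun_prop

lemma measurable_srho_rpow {m : ℕ} (s : ℝ) :
    Measurable fun x : SPoint m => ENNReal.ofReal (srho x ^ s) := by
  have := (continuous_srho (m := m)).measurable
  fun_prop

/-- Integrals of `|K(z,·) f|` against a Carleson measure are dominated by integrals against
Lebesgue measure. -/
lemma carleson_lintegral_le {m : ℕ} {q : ℝ} (hq : 0 < q) {μ : Measure (SPoint m)}
    [SFinite (μ.restrict (Siegel m))] {C : ℝ}
    (hC : ∀ f : SPoint m → ℂ, DifferentiableOn ℂ f (Siegel m) →
      IntegrableOn (fun z => ‖f z‖ ^ q) (Siegel m) volume →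
      ∫⁻ z in Siegel m, ENNReal.ofReal (‖f z‖ ^ q) ∂μ ≤
        ENNReal.ofReal C * ∫⁻ z in Siegel m, ENNReal.ofReal (‖f z‖ ^ q)) :
    ∃ B : ENNReal, B ≠ ⊤ ∧ ∀ f : SPoint m → ℂ, DifferentiableOn ℂ f (Siegel m) →
      ∀ z ∈ Siegel m,
        ∫⁻ w in Siegel m, ENNReal.ofReal (‖srho2 z w‖ ^ (-((m : ℝ) + 2))) * ‖f w‖ₑ ∂μ ≤
          B * ∫⁻ w in Siegel m, ENNReal.ofReal (‖srho2 z w‖ ^ (-((m : ℝ) + 2))) * ‖f w‖ₑ := by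
  obtain ⟨C', hC', hnear⟩ := carleson_measure_nearPairs_le hq hC
  obtain ⟨c, hc, havg⟩ := enorm_le_average m
  set s : ℝ := (m : ℝ) + 2 with hs
  have hs0 : 0 < s := by positivity
  clear_value s
  refine ⟨c * ENNReal.ofReal (2 ^ s * 2 ^ s) * C', ENNReal.mul_ne_top (ENNReal.mul_ne_top hc
    ENNReal.ofReal_ne_top) hC', fun f hf z hz => ?_⟩
  let H : SPoint m → ENNReal := fun x => ENNReal.ofReal (‖srho2 z x‖ ^ (-s)) *
    ENNReal.ofReal (srho x ^ (-s)) * (Siegel m).indicator (fun w => ‖f w‖ₑ) x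
  have hH : Measurable H := by
    exact ((measurable_srho2_rpow_right z (-s)).mul (measurable_srho_rpow (-s))).mul (measurable_indicator_enorm hf)
  have hpt : ∀ w ∈ Siegel m, ENNReal.ofReal (‖srho2 z w‖ ^ (-s)) * ‖f w‖ₑ ≤
      c * ENNReal.ofReal (2 ^ s * 2 ^ s) *
        ∫⁻ x, (nearPairs m).indicator (fun x => H x.2) (w, x) := by
    intro w hw
    have hw' : 0 < srho w := hw
    calc ENNReal.ofReal (‖srho2 z w‖ ^ (-s)) * ‖f w‖ₑ
        ≤ ENNReal.ofReal (‖srho2 z w‖ ^ (-s)) * (c * ENNReal.ofReal (srho w ^ (-s)) *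
          ∫⁻ x, (nearPairs m).indicator (fun x => ‖f x.2‖ₑ) (w, x)) := by
          gcongr
          exact havg f hf w hw
      _ = c * (ENNReal.ofReal (‖srho2 z w‖ ^ (-s) * srho w ^ (-s)) *
          ∫⁻ x, (nearPairs m).indicator (fun x => ‖f x.2‖ₑ) (w, x)) := by
          rw [ENNReal.ofReal_mul (by positivity)]
          ring
      _ = c * ∫⁻ x, ENNReal.ofReal (‖srho2 z w‖ ^ (-s) * srho w ^ (-s)) *
          (nearPairs m).indicator (fun x => ‖f x.2‖ₑ) (w, x) := by
          rw [lintegral_const_mul' _ _ ENNReal.ofReal_ne_top]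
      _ ≤ c * ∫⁻ x, ENNReal.ofReal (2 ^ s * 2 ^ s) *
          (nearPairs m).indicator (fun x => H x.2) (w, x) := by
          refine mul_le_mul_right (lintegral_mono fun x => ?_) _
          by_cases hn : (w, x) ∈ nearPairs m
          · have h1 := norm_srho2_heis_le hz hw hn
            have h2 := (srho_heis_bounds hn).2
            have hx := heis_mem_siegel hw hn
            simp only [heis_heisInv] at h1 h2 hx
            have hx' : 0 < srho x := hx
            have hR := norm_srho2_pos hz hx
            have hcmp : ∀ a b : ℝ, 0 < a → a ≤ 2 * b → b ^ (-s) ≤ 2 ^ s * a ^ (-s) := by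
              intro a b ha hab
              have hb : 0 < b := by linarith
              have h := Real.rpow_le_rpow_of_nonpos ha hab (neg_nonpos.2 hs0.le)
              rw [Real.mul_rpow (by norm_num) hb.le, Real.rpow_neg (by norm_num)] at h
              have h2s : (0 : ℝ) < 2 ^ s := by positivity
              calc b ^ (-s) = 2 ^ s * ((2 ^ s)⁻¹ * b ^ (-s)) := by field_simp
                _ ≤ _ := by gcongr
            simp only [Set.indicator_of_mem hn, H, Set.indicator_of_mem hx]
            have hle : ‖srho2 z w‖ ^ (-s) * srho w ^ (-s) ≤
                2 ^ s * 2 ^ s * (‖srho2 z x‖ ^ (-s) * srho x ^ (-s)) := by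
              calc ‖srho2 z w‖ ^ (-s) * srho w ^ (-s)
                  ≤ (2 ^ s * ‖srho2 z x‖ ^ (-s)) * (2 ^ s * srho x ^ (-s)) :=
                    mul_le_mul (hcmp _ _ hR h1) (hcmp _ _ hx' h2) (by positivity) (by positivity)
                _ = _ := by ring
            refine (mul_le_mul_left (ENNReal.ofReal_le_ofReal hle) _).trans_eq ?_
            rw [ENNReal.ofReal_mul (by positivity), ENNReal.ofReal_mul (p := ‖_‖ ^ _) (by positivity),
              mul_assoc]
          · simp [Set.indicator_of_notMem hn]
      _ = _ := by
          rw [lintegral_const_mul' _ _ ENNReal.ofReal_ne_top, mul_assoc]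
  have hmeas : Measurable fun x : SPoint m × SPoint m =>
      (nearPairs m).indicator (fun x => H x.2) x :=
    (hH.comp measurable_snd).indicator (isOpen_nearPairs m).measurableSet
  calc _ ≤ ∫⁻ w in Siegel m, (c * ENNReal.ofReal (2 ^ s * 2 ^ s) *
        ∫⁻ x, (nearPairs m).indicator (fun x => H x.2) (w, x)) ∂μ :=
        setLIntegral_mono' (measurableSet_siegel m) hpt
    _ = c * ENNReal.ofReal (2 ^ s * 2 ^ s) * ∫⁻ w in Siegel m,
        (∫⁻ x, (nearPairs m).indicator (fun x => H x.2) (w, x)) ∂μ :=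
        lintegral_const_mul _ hmeas.lintegral_prod_right'
    _ = c * ENNReal.ofReal (2 ^ s * 2 ^ s) * ∫⁻ x, (∫⁻ w in Siegel m,
        (nearPairs m).indicator (fun x => H x.2) (w, x) ∂μ) := by
        rw [lintegral_lintegral_swap (f := fun w x =>
          (nearPairs m).indicator (fun x => H x.2) (w, x)) hmeas.aemeasurable]
    _ ≤ c * ENNReal.ofReal (2 ^ s * 2 ^ s) * ∫⁻ x, C' * (Siegel m).indicator
        (fun w => ENNReal.ofReal (‖srho2 z w‖ ^ (-s)) * ‖f w‖ₑ) x := by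
        refine mul_le_mul_right (lintegral_mono fun x => ?_) _
        have hind : ∀ w, (nearPairs m).indicator (fun x => H x.2) (w, x) =
            {w | (w, x) ∈ nearPairs m}.indicator (fun _ => H x) w := fun w => rfl
        simp_rw [hind]
        rw [lintegral_indicator_const (show MeasurableSet {w | (w, x) ∈ nearPairs m} from
          measurable_prodMk_right (isOpen_nearPairs m).measurableSet)]
        by_cases hx : x ∈ Siegel m
        · have hx' : 0 < srho x := hx
          calc _ ≤ H x * (C' * ENNReal.ofReal (srho x ^ s)) := by
                gcongr
                exact hnear x hx
            _ = C' * (ENNReal.ofReal (‖srho2 z x‖ ^ (-s)) * ‖f x‖ₑ) *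
                (ENNReal.ofReal (srho x ^ (-s)) * ENNReal.ofReal (srho x ^ s)) := by
                simp only [H, Set.indicator_of_mem hx]
                ring
            _ = _ := by
                rw [← ENNReal.ofReal_mul (by positivity), ← Real.rpow_add hx',
                  Set.indicator_of_mem hx]
                simp
        · simp [H, hx]
    _ = _ := by
        rw [lintegral_const_mul' _ _ hC', lintegral_indicator (measurableSet_siegel m), 
          ← mul_assoc]

lemma sFinite_of_lintegral_ne_top {X : Type*} [MeasurableSpace X] {ν : Measure X} {g : X → ENNReal}
    (hg : Measurable g) (h0 : ∀ᵐ x ∂ν, g x ≠ 0) (htop : ∀ᵐ x ∂ν, g x ≠ ⊤)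
    (hInt : ∫⁻ x, g x ∂ν ≠ ⊤) : SFinite ν := by
  have : IsFiniteMeasure (ν.withDensity g) := isFiniteMeasure_withDensity hInt
  rw [← withDensity_inv_same hg h0 htop]
  infer_instance

/-- The positive Bergman operator is bounded on `Lᵖ` for `1 < p < ∞`. -/
lemma bergman_lintegral_rpow_le (m : ℕ) {p : ℝ} (hp : 1 < p) :
    ∃ A : ENNReal, A ≠ ⊤ ∧ ∀ f : SPoint m → ℂ, DifferentiableOn ℂ f (Siegel m) →
      ∫⁻ z in Siegel m, (∫⁻ w in Siegel m,
        ENNReal.ofReal (‖srho2 z w‖ ^ (-((m : ℝ) + 2))) * ‖f w‖ₑ) ^ p ≤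
          A * ∫⁻ w in Siegel m, ‖f w‖ₑ ^ p := by
  obtain ⟨q, hpq⟩ : ∃ q, p.HolderConjugate q := ⟨_, Real.HolderConjugate.conjExponent hp⟩
  have hp0 := hpq.pos
  have hq0 := hpq.symm.pos
  have hq1 := hpq.symm.lt
  have hbase : ∀ r : ℝ, 1 < r → ∃ A : ENNReal, A ≠ ⊤ ∧ ∀ z ∈ Siegel m, ∫⁻ w in Siegel m,
      ENNReal.ofReal (‖srho2 z w‖ ^ (-((m : ℝ) + 2))) * ENNReal.ofReal (srho w ^ (-(1 / r))) ≤
        A * ENNReal.ofReal (srho z ^ (-(1 / r))) := by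
    intro r hr
    have hr1 : 1 / r < 1 := by rw [div_lt_one] <;> linarith
    have hr0 : 0 < 1 / r := by positivity
    obtain ⟨A, hA, h⟩ := forelli_rudin m (t := -(1 / r)) (N := (m : ℝ) + 2) (by linarith)
      (by linarith)
    refine ⟨A, hA, fun z hz => ?_⟩
    have h' := h z hz
    rw [show (m : ℝ) + 2 + -(1 / r) - (m + 2) = -(1 / r) by ring] at h'
    refine le_trans (le_of_eq ?_) h'
    refine setLIntegral_congr_fun (measurableSet_siegel m) fun w hw => ?_
    have hw' : 0 < srho w := hw
    rw [← ENNReal.ofReal_mul (by positivity), mul_comm]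
  obtain ⟨A₁, hA₁, h₁⟩ := hbase p hp
  obtain ⟨A₂, hA₂, h₂⟩ := hbase q hq1
  have hpow : ∀ w ∈ Siegel m, ∀ r r' : ℝ, 0 < r → 0 < r' →
      ENNReal.ofReal (srho w ^ (-(1 / (r * r')))) ^ r' = ENNReal.ofReal (srho w ^ (-(1 / r))) := by
    intro w hw r r' hr hr'
    have hw' : 0 < srho w := hw
    rw [ENNReal.ofReal_rpow_of_nonneg (by positivity) hr'.le, ← Real.rpow_mul hw'.le]
    congr 2
    field_simp
  refine ⟨(A₁ + A₂) ^ (p / q) * (A₁ + A₂), ENNReal.mul_ne_top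
    (ENNReal.rpow_ne_top_of_nonneg (by positivity) (ENNReal.add_ne_top.2 ⟨hA₁, hA₂⟩))
    (ENNReal.add_ne_top.2 ⟨hA₁, hA₂⟩), fun f hf => ?_⟩
  have key := schur_test (ν := volume.restrict (Siegel m)) (p := p) (q := q) (A := A₁ + A₂)
    (k := fun z w => ENNReal.ofReal (‖srho2 z w‖ ^ (-((m : ℝ) + 2))))
    (h := fun w => ENNReal.ofReal (srho w ^ (-(1 / (p * q)))))
    (f := (Siegel m).indicator fun w => ‖f w‖ₑ)
    (measurable_srho2_rpow _) hpq (measurable_srho_rpow _) ?_ ?_ ?_ ?_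
    (measurable_indicator_enorm hf)
  · have e1 : ∀ z, ∫⁻ w in Siegel m, ENNReal.ofReal (‖srho2 z w‖ ^ (-((m : ℝ) + 2))) *
        (Siegel m).indicator (fun w => ‖f w‖ₑ) w =
          ∫⁻ w in Siegel m, ENNReal.ofReal (‖srho2 z w‖ ^ (-((m : ℝ) + 2))) * ‖f w‖ₑ := by
      intro z
      refine setLIntegral_congr_fun (measurableSet_siegel m) fun w hw => ?_
      simp only [Set.indicator_of_mem hw]
    have e2 : ∫⁻ w in Siegel m, (Siegel m).indicator (fun w => ‖f w‖ₑ) w ^ p =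
        ∫⁻ w in Siegel m, ‖f w‖ₑ ^ p := by
      refine setLIntegral_congr_fun (measurableSet_siegel m) fun w hw => ?_
      simp only [Set.indicator_of_mem hw]
    simpa only [e1, e2] using key
  · refine ae_restrict_of_forall_mem (measurableSet_siegel m) fun w hw => ?_
    have hw' : 0 < srho w := hw
    exact (ENNReal.ofReal_pos.2 (by positivity)).ne'
  · exact ae_of_all _ fun w => ENNReal.ofReal_ne_top
  · refine ae_restrict_of_forall_mem (measurableSet_siegel m) fun z hz => ?_
    rw [hpow z hz p q hp0 hq0]
    refine le_trans (le_of_eq ?_) ((h₁ z hz).trans (by gcongr; exact le_self_add))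
    refine setLIntegral_congr_fun (measurableSet_siegel m) fun w hw => ?_
    simp only [hpow w hw p q hp0 hq0]
  · refine ae_restrict_of_forall_mem (measurableSet_siegel m) fun z hz => ?_
    rw [mul_comm p q, hpow z hz q p hq0 hp0]
    refine le_trans (le_of_eq ?_) ((h₂ z hz).trans (by gcongr; exact le_add_self))
    refine setLIntegral_congr_fun (measurableSet_siegel m) fun w hw => ?_
    simp only [hpow w hw q p hq0 hp0, norm_srho2_comm]

/-- The integral defining the positive Bergman operator converges on `Lᵖ`. -/
lemma bergman_lintegral_lt_top {m : ℕ} {p : ℝ} (hp : 1 < p) {f : SPoint m → ℂ}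
    (hf : DifferentiableOn ℂ f (Siegel m)) (hfp : ∫⁻ w in Siegel m, ‖f w‖ₑ ^ p < ⊤)
    {z : SPoint m} (hz : z ∈ Siegel m) :
    ∫⁻ w in Siegel m, ENNReal.ofReal (‖srho2 z w‖ ^ (-((m : ℝ) + 2))) * ‖f w‖ₑ < ⊤ := by
  obtain ⟨q, hpq⟩ : ∃ q, p.HolderConjugate q := ⟨_, Real.HolderConjugate.conjExponent hp⟩
  have hp0 := hpq.pos
  have hq0 := hpq.symm.pos
  have hq1 := hpq.symm.lt
  have hmeas : AEMeasurable (fun w => ‖f w‖ₑ) (volume.restrict (Siegel m)) :=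
    (hf.continuousOn.aemeasurable (measurableSet_siegel m)).enorm
  refine (ENNReal.lintegral_mul_le_Lp_mul_Lq _ hpq.symm
    (measurable_srho2_rpow_right z _).aemeasurable hmeas).trans_lt ?_
  refine ENNReal.mul_lt_top (ENNReal.rpow_lt_top_of_nonneg (by positivity) ?_)
    (ENNReal.rpow_lt_top_of_nonneg (by positivity) hfp.ne)
  obtain ⟨A, hA, h⟩ := forelli_rudin m (t := 0) (N := ((m : ℝ) + 2) * q) (by norm_num)
    (by have : (0 : ℝ) ≤ m := by positivity
        nlinarith)
  refine ne_top_of_le_ne_top (ENNReal.mul_ne_top hA ENNReal.ofReal_ne_top)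
    (le_trans (le_of_eq ?_) (h z hz))
  refine lintegral_congr fun w => ?_
  rw [ENNReal.ofReal_rpow_of_nonneg (by positivity) hq0.le, ← Real.rpow_mul (norm_nonneg _), Real.rpow_zero,
    one_mul, neg_mul]

lemma norm_srho2_I {m : ℕ} (z : SPoint m) :
    ‖srho2 ((0, Complex.I) : SPoint m) z‖ = ‖z.2 + Complex.I‖ / 2 := by
  rw [norm_srho2_comm]
  have : srho2 z ((0, Complex.I) : SPoint m) = -(Complex.I / 2) * (z.2 + Complex.I) := by
    simp [srho2]
    ring
  rw [this, norm_mul]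
  simp
  ring

lemma I_mem_siegel (m : ℕ) : ((0, Complex.I) : SPoint m) ∈ Siegel m := by
  simp [Siegel, srho]

lemma norm_add_I_pos {m : ℕ} {z : SPoint m} (hz : z ∈ Siegel m) : 0 < ‖z.2 + Complex.I‖ := by
  have := norm_srho2_pos (I_mem_siegel m) hz
  rw [norm_srho2_I] at this
  linarith

lemma lintegral_rpow_lt_top_of_growth {m : ℕ} {p α M : ℝ} (hp : 0 < p)
    (hα : (m : ℝ) + 2 < α * p) {f : SPoint m → ℂ}
    (hM : ∀ z ∈ Siegel m, ‖z.2 + Complex.I‖ ^ α * ‖f z‖ ≤ M) :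
    ∫⁻ w in Siegel m, ‖f w‖ₑ ^ p < ⊤ := by
  obtain ⟨A, hA, h⟩ := forelli_rudin m (t := 0) (N := α * p) (by norm_num) (by linarith)
  have hlt := (h _ (I_mem_siegel m)).trans_lt (ENNReal.mul_lt_top hA.lt_top ENNReal.ofReal_lt_top)
  refine lt_of_le_of_lt (b := ENNReal.ofReal ((2 ^ (-α) * M) ^ p) * ∫⁻ w in Siegel m,
    ENNReal.ofReal (srho w ^ (0 : ℝ) * ‖srho2 ((0, Complex.I) : SPoint m) w‖ ^ (-(α * p)))) ?_
    (ENNReal.mul_lt_top ENNReal.ofReal_lt_top hlt)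
  rw [← lintegral_const_mul' _ _ ENNReal.ofReal_ne_top]
  refine setLIntegral_mono' (measurableSet_siegel m) fun w hw => ?_
  have hpos := norm_add_I_pos hw
  have hM0 : 0 ≤ M := le_trans (by positivity) (hM w hw)
  have h1 : ‖f w‖ ≤ 2 ^ (-α) * M * ‖srho2 ((0, Complex.I) : SPoint m) w‖ ^ (-α) := by
    rw [norm_srho2_I, Real.div_rpow hpos.le (by norm_num), Real.rpow_neg hpos.le]
    have h2 : (0 : ℝ) < 2 ^ (-α) := by positivity
    have h3 : 0 < ‖w.2 + Complex.I‖ ^ α := by positivity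
    have := hM w hw
    rw [show (2 : ℝ) ^ (-α) * M * ((‖w.2 + Complex.I‖ ^ α)⁻¹ / 2 ^ (-α)) =
      M / ‖w.2 + Complex.I‖ ^ α by field_simp, le_div_iff₀ h3]
    linarith
  rw [← ofReal_norm, ENNReal.ofReal_rpow_of_nonneg (norm_nonneg _) hp.le,
    ← ENNReal.ofReal_mul (by positivity)]
  refine ENNReal.ofReal_le_ofReal ?_
  refine (Real.rpow_le_rpow (norm_nonneg _) h1 hp.le).trans_eq ?_
  rw [Real.mul_rpow (by positivity) (by positivity), ← Real.rpow_mul (norm_nonneg _)]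
  simp

/-- The linear part of the affine map `z ↦ srho2 z w`. -/
noncomputable def srho2Linear {m : ℕ} (w : SPoint m) : SPoint m →L[ℂ] ℂ :=
  -(Complex.I / 2) • ContinuousLinearMap.snd ℂ (Fin m → ℂ) ℂ -
    ∑ j, (starRingEnd ℂ) (w.1 j) • (ContinuousLinearMap.proj (R := ℂ) (φ := fun _ => ℂ) j).comp
      (ContinuousLinearMap.fst ℂ (Fin m → ℂ) ℂ)

lemma hasFDerivAt_srho2 {m : ℕ} (w z : SPoint m) :
    HasFDerivAt (fun z => srho2 z w) (srho2Linear w) z := by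
  have h := ((srho2Linear w).hasFDerivAt (x := z)).const_add
    (Complex.I / 2 * (starRingEnd ℂ) w.2)
  refine h.congr_of_eventuallyEq (Eventually.of_forall fun x => ?_)
  simp [srho2, srho2Linear, mul_comm]
  ring

lemma continuous_srho2Linear {m : ℕ} : Continuous (srho2Linear (m := m)) := by
  have : ∀ j : Fin m, Continuous fun w : SPoint m => (starRingEnd ℂ) (w.1 j) := fun j =>
    Complex.continuous_conj.comp ((continuous_apply j).comp continuous_fst)
  unfold srho2Linear
  fun_prop

/-- Cauchy-type integrals of powers of `srho2` are holomorphic. -/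
lemma differentiableAt_integral_srho2 {m : ℕ} (k : ℕ) {ν : Measure (SPoint m)}
    (hν : ∀ᵐ w ∂ν, w ∈ Siegel m) {g : SPoint m → ℂ} (hg : AEStronglyMeasurable g ν)
    {z₀ : SPoint m} (hz₀ : z₀ ∈ Siegel m)
    (hInt : Integrable (fun w => (srho2 z₀ w ^ k)⁻¹ * g w) ν) :
    DifferentiableAt ℂ (fun z => ∫ w, (srho2 z w ^ k)⁻¹ * g w ∂ν) z₀ := by
  have hopen : IsOpen {z : SPoint m | (z₀, z) ∈ nearPairs m} :=
    (isOpen_nearPairs m).preimage (Continuous.prodMk_right z₀)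
  have hmem : z₀ ∈ {z : SPoint m | (z₀, z) ∈ nearPairs m} := by
    have hz₀' : 0 < srho z₀ := hz₀
    have : heisInv z₀ z₀ = 0 := by
      have h := heisInv_heis z₀ 0
      rwa [heis_zero] at h
    simp [nearPairs, this, polydisc, hz₀']
    positivity
  obtain ⟨R, hR, hsub⟩ := Metric.isOpen_iff.1 hopen z₀ hmem
  have hdist : ∀ z ∈ Metric.ball z₀ R, ∀ w ∈ Siegel m, 0 < ‖srho2 z w‖ ∧
      ‖srho2 z₀ w‖ ≤ 2 * ‖srho2 z w‖ := by
    intro z hz w hw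
    have h1 := hsub hz
    have h2 := le_norm_srho2_heis hw hz₀ h1
    have h3 := heis_mem_siegel hz₀ h1
    simp only [heis_heisInv] at h2 h3
    rw [norm_srho2_comm w, norm_srho2_comm w] at h2
    exact ⟨norm_srho2_pos h3 hw, h2⟩
  have hbd : ∀ z ∈ Metric.ball z₀ R, ∀ w ∈ Siegel m,
      ‖(srho2 z w ^ k)⁻¹ * g w‖ ≤ 2 ^ k * ‖(srho2 z₀ w ^ k)⁻¹ * g w‖ := by
    intro z hz w hw
    obtain ⟨h1, h2⟩ := hdist z hz w hw
    have h0 := norm_srho2_pos hz₀ hw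
    simp only [norm_mul, norm_inv, norm_pow]
    rw [← mul_assoc]
    gcongr
    rw [inv_le_iff_one_le_mul₀ (by positivity)]
    calc (1 : ℝ) = (‖srho2 z₀ w‖ ^ k)⁻¹ * ‖srho2 z₀ w‖ ^ k := by field_simp
      _ ≤ (‖srho2 z₀ w‖ ^ k)⁻¹ * (2 * ‖srho2 z w‖) ^ k := by gcongr
      _ = _ := by rw [mul_pow]; ring
  have hderiv : ∀ z w, srho2 z w ≠ 0 → HasFDerivAt (fun z => (srho2 z w ^ k)⁻¹ * g w)
      (fderiv ℂ (fun z => (srho2 z w ^ k)⁻¹ * g w) z) z := by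
    intro z w h
    refine DifferentiableAt.hasFDerivAt ?_
    have := differentiable_srho2 w z
    exact ((this.pow k).inv (pow_ne_zero _ h)).mul_const _
  have hmeas : ∀ z, AEStronglyMeasurable (fun w => (srho2 z w ^ k)⁻¹ * g w) ν := by
    intro z
    have h : Measurable fun w => srho2 z w :=
      (continuous_srho2.comp (Continuous.prodMk_right z)).measurable
    exact ((h.pow_const k).inv.aestronglyMeasurable).mul hg
  refine (hasFDerivAt_integral_of_dominated_of_fderiv_le (𝕜 := ℂ)
    (F := fun z w => (srho2 z w ^ k)⁻¹ * g w)
    (F' := fun z w => fderiv ℂ (fun z => (srho2 z w ^ k)⁻¹ * g w) z)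
    (bound := fun w => 2 * (2 ^ k * ‖(srho2 z₀ w ^ k)⁻¹ * g w‖) / (R / 2))
    (Metric.ball_mem_nhds z₀ (half_pos hR)) (Eventually.of_forall hmeas) hInt ?_ ?_ ?_
    ?_).differentiableAt
  · have h : Measurable fun w => srho2 z₀ w :=
      (continuous_srho2.comp (Continuous.prodMk_right z₀)).measurable
    have hs : AEStronglyMeasurable (fun w => -(k * srho2 z₀ w ^ (k - 1)) /
        (srho2 z₀ w ^ k) ^ 2 * g w) ν :=
      AEStronglyMeasurable.mul (Measurable.aestronglyMeasurable (by fun_prop)) hg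
    refine (hs.smul continuous_srho2Linear.aestronglyMeasurable).congr ?_
    filter_upwards [hν] with w hw
    have h0 : srho2 z₀ w ≠ 0 := norm_pos_iff.1 (norm_srho2_pos hz₀ hw)
    have hd := ((hasDerivAt_pow k (srho2 z₀ w)).fun_inv (pow_ne_zero k h0)).mul_const (g w)
    exact (hd.comp_hasFDerivAt z₀ (hasFDerivAt_srho2 w z₀)).fderiv.symm
  · filter_upwards [hν] with w hw z hz
    have hsub' : Metric.ball z (R / 2) ⊆ Metric.ball z₀ R :=
      Metric.ball_subset_ball' (by rw [Metric.mem_ball] at hz; linarith)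
    refine Complex.norm_fderiv_le_div_of_mapsTo_ball (fun x hx => ?_) (fun x hx => ?_)
      (half_pos hR)
    · exact (hderiv x w (norm_pos_iff.1 (hdist x (hsub' hx) w hw).1)).differentiableAt
        |>.differentiableWithinAt
    · rw [mem_closedBall_iff_norm, two_mul]
      exact (norm_sub_le _ _).trans (add_le_add (hbd x (hsub' hx) w hw)
        (hbd z (hsub' (Metric.mem_ball_self (half_pos hR))) w hw))
  · exact ((hInt.norm.const_mul _).const_mul _).div_const _
  · filter_upwards [hν] with w hw z hz
    exact hderiv z w (norm_pos_iff.1 (hdist z (Metric.ball_subset_ball (by linarith) hz) w hw).1)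

lemma setIntegral_norm_rpow {m : ℕ} {p : ℝ} (hp : 0 < p) {g : SPoint m → ℂ}
    (hg : DifferentiableOn ℂ g (Siegel m)) :
    ∫ z in Siegel m, ‖g z‖ ^ p = (∫⁻ z in Siegel m, ‖g z‖ₑ ^ p).toReal := by
  have hc : ContinuousOn (fun z => ‖g z‖ ^ p) (Siegel m) :=
    hg.continuousOn.norm.rpow_const fun _ _ => Or.inr hp.le
  rw [integral_eq_lintegral_of_nonneg_ae (ae_of_all _ fun z => by positivity)
    (hc.aestronglyMeasurable (measurableSet_siegel m))]
  congr 1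
  refine lintegral_congr fun z => ?_
  rw [← ofReal_norm, ENNReal.ofReal_rpow_of_nonneg (norm_nonneg _) hp.le]

lemma integrableOn_norm_rpow {m : ℕ} {p : ℝ} (hp : 0 < p) {g : SPoint m → ℂ}
    (hg : DifferentiableOn ℂ g (Siegel m)) (hfin : ∫⁻ z in Siegel m, ‖g z‖ₑ ^ p < ⊤) :
    IntegrableOn (fun z => ‖g z‖ ^ p) (Siegel m) := by
  have hc : ContinuousOn (fun z => ‖g z‖ ^ p) (Siegel m) :=
    hg.continuousOn.norm.rpow_const fun _ _ => Or.inr hp.le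
  refine ⟨hc.aestronglyMeasurable (measurableSet_siegel m), ?_⟩
  rw [hasFiniteIntegral_iff_ofReal (ae_of_all _ fun z => by positivity)]
  refine lt_of_eq_of_lt (lintegral_congr fun z => ?_) hfin
  rw [← ofReal_norm, ENNReal.ofReal_rpow_of_nonneg (norm_nonneg _) hp.le]

lemma enorm_inv_srho2_pow {m : ℕ} (z w : SPoint m) :
    ‖(srho2 z w ^ (m + 2))⁻¹‖ₑ = ENNReal.ofReal (‖srho2 z w‖ ^ (-((m : ℝ) + 2))) := by
  rw [← ofReal_norm, norm_inv, norm_pow, Real.rpow_neg (norm_nonneg _)]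
  congr 2
  exact_mod_cast (Real.rpow_natCast ‖srho2 z w‖ (m + 2)).symm

lemma toeplitz_bounded_of_carleson {m : ℕ} {q : ℝ} (hq : 0 < q) {p : ℝ} (hp : 1 < p)
    {μ : Measure (SPoint m)} [SFinite (μ.restrict (Siegel m))] {C : ℝ}
    (hC : ∀ f : SPoint m → ℂ, DifferentiableOn ℂ f (Siegel m) →
      IntegrableOn (fun z => ‖f z‖ ^ q) (Siegel m) volume →
      ∫⁻ z in Siegel m, ENNReal.ofReal (‖f z‖ ^ q) ∂μ ≤
        ENNReal.ofReal C * ∫⁻ z in Siegel m, ENNReal.ofReal (‖f z‖ ^ q)) :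
    ∃ D : ℝ, 0 < D ∧ ∀ f : SPoint m → ℂ, DifferentiableOn ℂ f (Siegel m) →
      ∫⁻ w in Siegel m, ‖f w‖ₑ ^ p < ⊤ →
        MemAp (m + 1) p (fun z => ∫ w in Siegel m, sK (m + 1) z w * f w ∂μ) ∧
        bNorm (m + 1) p (fun z => ∫ w in Siegel m, sK (m + 1) z w * f w ∂μ) ≤
          D * bNorm (m + 1) p f := by
  obtain ⟨B, hB, hcar⟩ := carleson_lintegral_le hq hC
  obtain ⟨A, hA, hschur⟩ := bergman_lintegral_rpow_le m hp
  have hp0 : 0 < p := by linarith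
  set c : ℂ := ((m + 1).factorial : ℂ) / (4 * (Real.pi : ℂ) ^ (m + 1)) with hc
  set Λ : ENNReal := (‖c‖ₑ * B) ^ p * A with hΛdef
  have hcB : ‖c‖ₑ * B ≠ ⊤ := ENNReal.mul_ne_top enorm_ne_top hB
  have hΛ : Λ ≠ ⊤ := ENNReal.mul_ne_top (ENNReal.rpow_ne_top_of_nonneg hp0.le hcB) hA
  refine ⟨Λ.toReal ^ (1 / p) + 1, by positivity, fun f hf hfp => ?_⟩
  set T : SPoint m → ℂ := fun z => ∫ w in Siegel m, sK (m + 1) z w * f w ∂μ with hT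
  have hTeq : ∀ z, T z = c * ∫ w in Siegel m, (srho2 z w ^ (m + 2))⁻¹ * f w ∂μ := by
    intro z
    rw [← integral_const_mul]
    refine integral_congr_ae (ae_of_all _ fun w => ?_)
    have : (-(((m + 1 : ℕ) : ℤ) + 1)) = -((m + 2 : ℕ) : ℤ) := by push_cast; ring
    simp only [sK]
    rw [this, zpow_neg, zpow_natCast, mul_assoc]
  have hmem : ∀ᵐ w ∂μ.restrict (Siegel m), w ∈ Siegel m :=
    ae_restrict_mem (measurableSet_siegel m)
  have hfm : AEStronglyMeasurable f (μ.restrict (Siegel m)) :=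
    hf.continuousOn.aestronglyMeasurable (measurableSet_siegel m)
  have hle : ∀ z ∈ Siegel m, ∫⁻ w in Siegel m, ‖(srho2 z w ^ (m + 2))⁻¹ * f w‖ₑ ∂μ ≤
      B * ∫⁻ w in Siegel m, ENNReal.ofReal (‖srho2 z w‖ ^ (-((m : ℝ) + 2))) * ‖f w‖ₑ := by
    intro z hz
    refine le_trans (le_of_eq ?_) (hcar f hf z hz)
    refine lintegral_congr fun w => ?_
    rw [enorm_mul, enorm_inv_srho2_pow]
  have hInt : ∀ z ∈ Siegel m,
      Integrable (fun w => (srho2 z w ^ (m + 2))⁻¹ * f w) (μ.restrict (Siegel m)) := by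
    intro z hz
    have h : Measurable fun w => srho2 z w :=
      (continuous_srho2.comp (Continuous.prodMk_right z)).measurable
    refine ⟨(h.pow_const _).inv.aestronglyMeasurable.mul hfm, (hle z hz).trans_lt ?_⟩
    exact ENNReal.mul_lt_top hB.lt_top (bergman_lintegral_lt_top hp hf hfp hz)
  have hTd : DifferentiableOn ℂ T (Siegel m) := by
    intro z hz
    rw [funext hTeq]
    exact ((differentiableAt_integral_srho2 (m + 2) hmem hfm hz (hInt z hz)).const_mul
      c).differentiableWithinAt
  have hTle : ∫⁻ z in Siegel m, ‖T z‖ₑ ^ p ≤ Λ * ∫⁻ z in Siegel m, ‖f z‖ₑ ^ p := by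
    calc ∫⁻ z in Siegel m, ‖T z‖ₑ ^ p
        ≤ ∫⁻ z in Siegel m, (‖c‖ₑ * B) ^ p * (∫⁻ w in Siegel m,
          ENNReal.ofReal (‖srho2 z w‖ ^ (-((m : ℝ) + 2))) * ‖f w‖ₑ) ^ p := by
          refine setLIntegral_mono' (measurableSet_siegel m) fun z hz => ?_
          rw [← ENNReal.mul_rpow_of_nonneg _ _ hp0.le, hTeq, enorm_mul, mul_assoc]
          refine ENNReal.rpow_le_rpow (mul_le_mul_right ?_ _) hp0.le
          exact (enorm_integral_le_lintegral_enorm _).trans (hle z hz)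
      _ = (‖c‖ₑ * B) ^ p * ∫⁻ z in Siegel m, (∫⁻ w in Siegel m,
          ENNReal.ofReal (‖srho2 z w‖ ^ (-((m : ℝ) + 2))) * ‖f w‖ₑ) ^ p :=
          lintegral_const_mul' _ _ (ENNReal.rpow_ne_top_of_nonneg hp0.le hcB)
      _ ≤ _ := by
          rw [hΛdef, mul_assoc]
          exact mul_le_mul_right (hschur f hf) _
  have hprod := ENNReal.mul_ne_top hΛ hfp.ne
  refine ⟨⟨hTd, integrableOn_norm_rpow hp0 hTd (hTle.trans_lt hprod.lt_top)⟩, ?_⟩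
  change (∫ z in Siegel m, ‖T z‖ ^ p) ^ (1 / p) ≤
    (Λ.toReal ^ (1 / p) + 1) * (∫ z in Siegel m, ‖f z‖ ^ p) ^ (1 / p)
  rw [setIntegral_norm_rpow hp0 hTd, setIntegral_norm_rpow hp0 hf]
  have h1 := ENNReal.toReal_mono hprod hTle
  rw [ENNReal.toReal_mul] at h1
  calc _ ≤ (Λ.toReal * (∫⁻ z in Siegel m, ‖f z‖ₑ ^ p).toReal) ^ (1 / p) :=
        Real.rpow_le_rpow ENNReal.toReal_nonneg h1 (by positivity)
    _ = Λ.toReal ^ (1 / p) * (∫⁻ z in Siegel m, ‖f z‖ₑ ^ p).toReal ^ (1 / p) :=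
        Real.mul_rpow ENNReal.toReal_nonneg ENNReal.toReal_nonneg
    _ ≤ _ := by
        gcongr
        linarith

lemma sFinite_restrict_siegel {m : ℕ} {μ : Measure (SPoint m)} {α : ℝ}
    (h : ∫⁻ w in Siegel m, ENNReal.ofReal (‖w.2 + Complex.I‖ ^ (-α)) ∂μ < ⊤) :
    SFinite (μ.restrict (Siegel m)) := by
  refine sFinite_of_lintegral_ne_top (by fun_prop) ?_ (ae_of_all _ fun _ => ENNReal.ofReal_ne_top)
    h.ne
  refine ae_restrict_of_forall_mem (measurableSet_siegel m) fun w hw => ?_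
  have := norm_add_I_pos hw
  exact (ENNReal.ofReal_pos.2 (by positivity)).ne'

/-- if `μ ∈ ℳ₊` is a Carleson measure for some `A^q(𝒰)`, then `T_μ` is
bounded on the dense subspace `𝒮_α` of `Aᵖ(𝒰)`, hence extends to a bounded operator. -/
theorem toeplitz_bounded (n : ℕ) (hn : 1 ≤ n) (q : ℝ) (hq : 0 < q)
    (p : ℝ) (hp : 1 < p) (α : ℝ) (hα1 : (n : ℝ) + 1 / p < α) (hα2 : α < (n : ℝ) + 1)
    (μ : Measure (SPoint (n - 1)))
    (hμM : ∃ α₀ : ℝ, 0 < α₀ ∧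
      ∫⁻ w in Siegel (n - 1),
        ENNReal.ofReal (‖w.2 + Complex.I‖ ^ (-α₀)) ∂μ < ⊤)
    (hμC : ∃ C : ℝ, 0 < C ∧ ∀ f : SPoint (n - 1) → ℂ, MemAp n q f →
      ∫⁻ z in Siegel (n - 1), ENNReal.ofReal (‖f z‖ ^ q) ∂μ ≤
        ENNReal.ofReal C * ∫⁻ z in Siegel (n - 1), ENNReal.ofReal (‖f z‖ ^ q)) :
    ∃ C : ℝ, 0 < C ∧ ∀ f : SPoint (n - 1) → ℂ, SAlpha n α f →
      MemAp n p (fun z => ∫ w in Siegel (n - 1), sK n z w * f w ∂μ) ∧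
        bNorm n p (fun z => ∫ w in Siegel (n - 1), sK n z w * f w ∂μ) ≤
          C * bNorm n p f := by
  obtain ⟨m, rfl⟩ : ∃ m, n = m + 1 := ⟨n - 1, by omega⟩
  obtain ⟨α₀, -, hfin⟩ := hμM
  obtain ⟨C, -, hC⟩ := hμC
  have : SFinite (μ.restrict (Siegel m)) := sFinite_restrict_siegel hfin
  obtain ⟨D, hD, hmain⟩ := toeplitz_bounded_of_carleson (m := m) hq hp (μ := μ) (C := C)
    fun f hf hfi => hC f ⟨hf, hfi⟩
  refine ⟨D, hD, fun f hf => ?_⟩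
  obtain ⟨hfd, M, hM⟩ := hf
  refine hmain f hfd (lintegral_rpow_lt_top_of_growth (α := α) (by linarith) ?_ hM)
  have hp0 : 0 < p := by linarith
  have h1 : (((m + 1 : ℕ) : ℝ) + 1 / p) * p < α * p := by gcongr
  have h2 : (((m + 1 : ℕ) : ℝ) + 1 / p) * p = ((m : ℝ) + 1) * p + 1 := by
    push_cast
    field_simp
  have h3 : (0 : ℝ) ≤ m := by positivity
  nlinarith
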